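/- Let Σ_D be the (M,N) Dyck-Motzkin shift. There exists a dense subset 𝒟 of C(Σ_D) such that for every f ∈ 𝒟, the set M_max(f) contains uncountably many measures each of which is fully supported on Σ_D (gives positive measure to every non-empty open subset of Σ_D) and Bernoulli (the system (Σ_D, σ, μ) is measure-theoretically isomorphic to a two-sided Bernoulli shift). -/

import Mathlib

open MeasureTheory Topology Filter
open scoped ENNReal NNReal


/-! ### The alphabet of the (M,N) Dyck–Motzkin shift -/

/-- The alphabet `D = D_α ∪ D_0 ∪ D_β` of the `(M,N)` Dyck–Motzkin shift:
`la k` is the left bracket `α_k`, `u k` is the unit `1_k`, `ra k` is the right bracket `β_k`. -/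
inductive DMSym (M N : ℕ) : Type where
  | la : Fin M → DMSym M N
  | u  : Fin N → DMSym M N
  | ra : Fin M → DMSym M N
deriving DecidableEq

namespace DMSym

def equivSum (M N : ℕ) : DMSym M N ≃ (Fin M ⊕ Fin N ⊕ Fin M) where
  toFun s := match s with
    | .la k => Sum.inl k
    | .u k => Sum.inr (Sum.inl k)
    | .ra k => Sum.inr (Sum.inr k)
  invFun s := match s with
    | Sum.inl k => .la k
    | Sum.inr (Sum.inl k) => .u k
    | Sum.inr (Sum.inr k) => .ra k
  left_inv s := by cases s <;> rfl
  right_inv s := by rcases s with k | k | k <;> rfl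

instance (M N : ℕ) : Fintype (DMSym M N) := Fintype.ofEquiv _ (equivSum M N).symm
instance (M N : ℕ) : TopologicalSpace (DMSym M N) := ⊥
instance (M N : ℕ) : DiscreteTopology (DMSym M N) := ⟨rfl⟩
instance (M N : ℕ) : MeasurableSpace (DMSym M N) := ⊤
instance (M N : ℕ) : BorelSpace (DMSym M N) := ⟨borel_eq_top_of_discrete.symm⟩

end DMSym

/-- Nonzero elements of the Dyck–Motzkin monoid with zero are represented in normal form:
`some (bs, as)` is the reduced word `β_{bs(0)} ⋯ β_{bs(r)} α_{as(0)} ⋯ α_{as(s)}`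
(in particular `some ([], [])` is the unit element `1`); `none` is the zero element `0`. -/
abbrev DyckElem (M : ℕ) := Option (List (Fin M) × List (Fin M))

/-- Multiplication, in the Dyck–Motzkin monoid with zero, of an element in normal form on
the right by a generator: units are absorbed, a left bracket is appended, and a right bracket
either closes the last left bracket (if the indices match), is appended (if there is no left
bracket to close), or produces the zero element (if the indices do not match). -/
def dyckStep {M N : ℕ} : DyckElem M → DMSym M N → DyckElem M
  | none, _ => none
  | some (bs, as), .la k => some (bs, as ++ [k])
  | some (bs, as), .u _ => some (bs, as)
  | some (bs, as), .ra k =>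
      match as.getLast? with
      | none => some (bs ++ [k], [])
      | some j => if j = k then some (bs, as.dropLast) else none

/-- `red w` is the image of the word `w` in the Dyck–Motzkin monoid with zero. -/
def red {M N : ℕ} (w : List (DMSym M N)) : DyckElem M :=
  w.foldl dyckStep (some ([], []))

/-- The word `x_j x_{j+1} ⋯ x_k` read off a bi-infinite sequence `x`. -/
def wordAt {M N : ℕ} (x : ℤ → DMSym M N) (j k : ℤ) : List (DMSym M N) :=
  (List.range (k + 1 - j).toNat).map fun n => x (j + n)

/-- The `(M,N)` Dyck–Motzkin shift `Σ_D`. -/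
def SigmaD (M N : ℕ) : Set (ℤ → DMSym M N) :=
  {x | ∀ j k : ℤ, j < k → red (wordAt x j k) ≠ none}

/-- The left shift `σ`. -/
def shift {A : Type*} : (ℤ → A) → (ℤ → A) := fun x i => x (i + 1)

/-- The inverse `σ⁻¹` of the left shift. -/
def shiftInv {A : Type*} : (ℤ → A) → (ℤ → A) := fun x i => x (i - 1)

lemma wordAt_shift {M N : ℕ} (x : ℤ → DMSym M N) (j k : ℤ) :
    wordAt (shift x) j k = wordAt x (j + 1) (k + 1) := by
  simp only [wordAt, shift]
  rw [show (k + 1 + 1 - (j + 1) : ℤ) = k + 1 - j by ring]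
  exact List.map_congr_left fun n _ => by rw [show (j + n + 1 : ℤ) = j + 1 + n by ring]

lemma shift_mem_SigmaD {M N : ℕ} {x : ℤ → DMSym M N} (hx : x ∈ SigmaD M N) :
    shift x ∈ SigmaD M N := by
  intro j k hjk
  rw [wordAt_shift]
  exact hx (j + 1) (k + 1) (by omega)

/-- The left shift acting on `Σ_D`. -/
def shiftD (M N : ℕ) : ↥(SigmaD M N) → ↥(SigmaD M N) :=
  fun x => ⟨shift x.val, shift_mem_SigmaD x.property⟩

section Generic
variable {X : Type*} [MeasurableSpace X]

/-- The set of `T`-invariant Borel probability measures. -/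
def InvMeas (T : X → X) : Set (ProbabilityMeasure X) :=
  {μ | MeasurePreserving T μ.toMeasure μ.toMeasure}

/-- The set of `T`-invariant ergodic Borel probability measures. -/
def ErgMeas (T : X → X) : Set (ProbabilityMeasure X) :=
  {μ | Ergodic T μ.toMeasure}

/-- A `CO`-measure: an invariant ergodic probability measure supported on the orbit of a
single periodic point. -/
def IsCOMeas (T : X → X) (μ : ProbabilityMeasure X) : Prop :=
  Ergodic T μ.toMeasure ∧
    ∃ (x : X) (n : ℕ), 0 < n ∧ T^[n] x = x ∧
      μ.toMeasure {y | ∃ k : ℕ, y = T^[k] x} = 1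

/-- Convexity for a set of probability measures: it is stable under taking the convex
combination `t•μ + (1-t)•ν` of any two of its members. -/
def ConvexMeasSet (U : Set (ProbabilityMeasure X)) : Prop :=
  ∀ μ ∈ U, ∀ ν ∈ U, ∀ t : ℝ≥0∞, t ≤ 1 → ∀ ρ : ProbabilityMeasure X,
    ρ.toMeasure = t • μ.toMeasure + (1 - t) • ν.toMeasure → ρ ∈ U

/-- A measure is fully supported if it gives positive measure to every non-empty open set. -/
def FullSupp [TopologicalSpace X] (μ : ProbabilityMeasure X) : Prop :=
  ∀ U : Set X, IsOpen U → U.Nonempty → 0 < μ.toMeasure U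

/-- Measure-theoretic isomorphism of the measure-preserving systems `(X,T,μ)` and `(Y,S,ν)`. -/
def MeasureIso {Y : Type*} [MeasurableSpace Y] (T : X → X) (S : Y → Y)
    (μ : Measure X) (ν : Measure Y) : Prop :=
  ∃ (φ : X → Y) (ψ : Y → X), Measurable φ ∧ Measurable ψ ∧
    Measure.map φ μ = ν ∧ Measure.map ψ ν = μ ∧
    (∀ᵐ x ∂μ, ψ (φ x) = x) ∧ (∀ᵐ y ∂ν, φ (ψ y) = y) ∧
    (∀ᵐ x ∂μ, φ (T x) = S (φ x))

/-- The system `(X,T,μ)` is Bernoulli: it is measure-theoretically isomorphic to a two-sided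
Bernoulli shift, i.e. the left shift on `ℤ → ℕ` equipped with an i.i.d. product measure
(determined by requiring that the measures of all cylinder sets factorize according to a
fixed distribution `p`). -/
def IsBernoulli (T : X → X) (μ : Measure X) : Prop :=
  ∃ (p : ℕ → ℝ≥0∞) (ν : Measure (ℤ → ℕ)), (∑' n, p n) = 1 ∧
    IsProbabilityMeasure ν ∧
    (∀ (n : ℕ) (w : Fin n → ℕ) (j : ℤ),
      ν {y | ∀ i : Fin n, y (j + (i : ℕ)) = w i} = ∏ i, p (w i)) ∧
    MeasureIso T shift μ ν

end Generic

/-- `M(Σ_D)`: the space of shift-invariant Borel probability measures on `Σ_D`,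
endowed with the weak* topology. -/
def MinvD (M N : ℕ) : Set (ProbabilityMeasure ↥(SigmaD M N)) := InvMeas (shiftD M N)

/-- `M^e(Σ_D)`: the shift-invariant ergodic Borel probability measures on `Σ_D`. -/
def MergD (M N : ℕ) : Set (ProbabilityMeasure ↥(SigmaD M N)) := ErgMeas (shiftD M N)

/-- The integral `∫ f dμ`. -/
noncomputable def intCf {M N : ℕ} (f : C(↥(SigmaD M N), ℝ))
    (μ : ProbabilityMeasure ↥(SigmaD M N)) : ℝ := ∫ x, f x ∂μ.toMeasure

/-- `M_max(f)`: the set of `f`-maximizing measures, i.e. the shift-invariant measures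
attaining `sup { ∫ f dν : ν ∈ M(Σ_D) }`. -/
def Mmax (M N : ℕ) (f : C(↥(SigmaD M N), ℝ)) : Set (ProbabilityMeasure ↥(SigmaD M N)) :=
  {μ ∈ MinvD M N | ∀ ν ∈ MinvD M N, intCf f ν ≤ intCf f μ}


/-! ### Part 1 -/

open MeasureTheory Topology Filter
open scoped ENNReal NNReal

theorem ekeland_half {E : Type*} [MetricSpace E] [CompleteSpace E] (φ : E → ℝ)
    (hc : Continuous φ) (h0 : ∀ x, 0 ≤ φ x) (x0 : E) :
    ∃ x1, dist x0 x1 / 2 ≤ φ x0 - φ x1 ∧ ∀ y, φ x1 ≤ φ y + dist x1 y / 2 := by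
  classical
  let S : E → Set E := fun x => {y | φ y + dist x y / 2 ≤ φ x}
  have hself : ∀ x, x ∈ S x := fun x => by simp [S]
  have htr : ∀ x y z, y ∈ S x → z ∈ S y → z ∈ S x := by
    intro x y z h1 h2
    simp only [S, Set.mem_setOf_eq] at *
    have := dist_triangle x y z
    linarith
  have hstep : ∀ (x : E) (δ : ℝ), 0 < δ → ∃ y ∈ S x, ∀ z ∈ S x, φ y ≤ φ z + δ := by
    intro x δ hδ
    have hne : (φ '' S x).Nonempty := ⟨_, x, hself x, rfl⟩
    have hbd : BddBelow (φ '' S x) := ⟨0, by rintro _ ⟨y, _, rfl⟩; exact h0 y⟩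
    obtain ⟨_, ⟨y, hy, rfl⟩, hlt⟩ := exists_lt_of_csInf_lt hne
      (show sInf (φ '' S x) < sInf (φ '' S x) + δ by linarith)
    exact ⟨y, hy, fun z hz => by
      have := csInf_le hbd ⟨z, hz, rfl⟩
      linarith⟩
  choose g hg1 hg2 using hstep
  have hpos : ∀ n : ℕ, (0:ℝ) < (1/2)^n := fun n => by positivity
  let u : ℕ → E := fun n => Nat.rec x0 (fun n x => g x ((1/2)^n) (hpos n)) n
  have hu : ∀ n, u (n+1) = g (u n) ((1/2)^n) (hpos n) := fun n => rfl
  have hmono : ∀ n m, n ≤ m → u m ∈ S (u n) := by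
    intro n m h
    induction m, h using Nat.le_induction with
    | base => exact hself _
    | succ m _ ih => exact htr _ _ _ ih (by rw [hu]; exact hg1 _ _ _)
  have hanti : Antitone (fun n => φ (u n)) := by
    intro n m h
    have := hmono n m h
    simp only [S, Set.mem_setOf_eq] at this
    have := dist_nonneg (x := u n) (y := u m)
    linarith
  have hconv := tendsto_atTop_ciInf hanti ⟨0, by rintro _ ⟨n, rfl⟩; exact h0 _⟩
  set l := ⨅ i, φ (u i)
  have hl : ∀ n, l ≤ φ (u n) := fun n => hanti.le_of_tendsto hconv n
  have hcau : CauchySeq u := by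
    refine cauchySeq_of_le_tendsto_0 (fun n => 4 * (φ (u n) - l)) ?_ ?_
    · intro n m N hn hm
      have h1 := hmono N n hn
      have h2 := hmono N m hm
      simp only [S, Set.mem_setOf_eq] at h1 h2
      have := dist_triangle_left (u n) (u m) (u N)
      have := hl n
      have := hl m
      linarith
    · have := (hconv.sub_const l).const_mul 4
      simpa using this
  obtain ⟨x1, hx1⟩ := cauchySeq_tendsto_of_complete hcau
  have hx1S : ∀ n, x1 ∈ S (u n) := by
    intro n
    have hcl : IsClosed (S (u n)) := by
      apply isClosed_le <;> fun_prop
    exact hcl.mem_of_tendsto hx1 (eventually_atTop.2 ⟨n, fun m hm => hmono n m hm⟩)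
  refine ⟨x1, ?_, ?_⟩
  · have := hx1S 0
    simp only [S, Set.mem_setOf_eq] at this
    change φ x1 + dist x0 x1 / 2 ≤ φ x0 at this
    linarith
  · intro y
    by_contra hcon
    push Not at hcon
    have hy : y ∈ S x1 := hcon.le
    have hd := dist_nonneg (x := x1) (y := y)
    have key : ∀ n : ℕ, φ x1 ≤ φ y + (1/2)^n := by
      intro n
      have h1 := hg2 (u n) _ (hpos n) y (htr _ _ _ (hx1S n) hy)
      rw [← hu] at h1
      have h2 := hx1S (n+1)
      simp only [S, Set.mem_setOf_eq] at h2
      have := dist_nonneg (x := u (n+1)) (y := x1)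
      linarith
    have : φ x1 ≤ φ y + 0 := ge_of_tendsto' ((tendsto_pow_atTop_nhds_zero_of_lt_one
      (by norm_num) (by norm_num)).const_add (φ y)) key
    linarith

theorem sandwich_hb {E : Type*} [NormedAddCommGroup E] [NormedSpace ℝ E] (p q : E → ℝ)
    (hp : Continuous p) (hq : Continuous q) (hpc : ConvexOn ℝ Set.univ p)
    (hqc : ConcaveOn ℝ Set.univ q) (hp0 : p 0 = 0) (hq0 : q 0 = 0) (hqp : ∀ x, q x ≤ p x) :
    ∃ l : E →L[ℝ] ℝ, ∀ x, q x ≤ l x ∧ l x ≤ p x := by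
  let A : Set (E × ℝ) := {z | p z.1 < z.2}
  let B : Set (E × ℝ) := {z | z.2 < q z.1}
  have hA : IsOpen A := isOpen_lt (by fun_prop) (by fun_prop)
  have hB : IsOpen B := isOpen_lt (by fun_prop) (by fun_prop)
  have hAc : Convex ℝ A := by simpa [A] using hpc.convex_strict_epigraph
  have hBc : Convex ℝ B := by simpa [B] using hqc.convex_strict_hypograph
  have hd : Disjoint B A := by
    rw [Set.disjoint_left]
    intro z h1 h2
    have := hqp z.1
    simp only [A, B, Set.mem_setOf_eq] at h1 h2
    linarith
  obtain ⟨f, u, hf1, hf2⟩ := geometric_hahn_banach_open_open hBc hB hAc hA hd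
  set c := f (0, 1) with hcdef
  let f1 : E →L[ℝ] ℝ := f.comp (ContinuousLinearMap.inl ℝ E ℝ)
  have hfe : ∀ h r, f (h, r) = f1 h + r * c := by
    intro h r
    have : ((h, r) : E × ℝ) = (h, 0) + r • ((0, 1) : E × ℝ) := by simp
    rw [this, map_add, map_smul]
    simp [f1, hcdef]
  have h1 : ∀ h r, r < q h → f1 h + r * c < u := fun h r hr => by
    rw [← hfe]; exact hf1 (h, r) hr
  have h2 : ∀ h r, p h < r → u < f1 h + r * c := fun h r hr => by
    rw [← hfe]; exact hf2 (h, r) hr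
  have hc : 0 < c := by
    have e1 := h1 0 (-1) (by rw [hq0]; norm_num)
    have e2 := h2 0 1 (by rw [hp0]; norm_num)
    linarith
  have hlim1 : ∀ h, f1 h + q h * c ≤ u := by
    intro h
    by_contra hcon
    push Not at hcon
    have hk := h1 h (q h - (f1 h + q h * c - u) / c) (by
      have : 0 < (f1 h + q h * c - u) / c := div_pos (by linarith) hc
      linarith)
    rw [sub_mul, div_mul_cancel₀ _ hc.ne'] at hk
    linarith
  have hlim2 : ∀ h, u ≤ f1 h + p h * c := by
    intro h
    by_contra hcon
    push Not at hcon
    have hk := h2 h (p h + (u - (f1 h + p h * c)) / c) (by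
      have : 0 < (u - (f1 h + p h * c)) / c := div_pos (by linarith) hc
      linarith)
    rw [add_mul, div_mul_cancel₀ _ hc.ne'] at hk
    linarith
  have hu : u = 0 := by
    have e1 := hlim1 0
    have e2 := hlim2 0
    simp [hp0, hq0] at e1 e2
    linarith
  subst hu
  refine ⟨-(c⁻¹ • f1), fun x => ?_⟩
  have e1 := hlim1 x
  have e2 := hlim2 x
  simp only [ContinuousLinearMap.neg_apply, ContinuousLinearMap.smul_apply, smul_eq_mul]
  constructor
  · have : q x ≤ (- f1 x) / c := by rw [le_div_iff₀ hc]; linarith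
    rw [div_eq_inv_mul] at this; linarith
  · have : (- f1 x) / c ≤ p x := by rw [div_le_iff₀ hc]; linarith
    rw [div_eq_inv_mul] at this; linarith

/-! ### Part 2 -/

open MeasureTheory Topology Filter
open scoped ENNReal NNReal CompactlySupported
set_option linter.unusedSectionVars false

section PartI
variable {X : Type*} [TopologicalSpace X] [CompactSpace X] [T2Space X]
  [TopologicalSpace.PseudoMetrizableSpace X] [MeasurableSpace X] [BorelSpace X]

/-- invariant probability measures -/
def InvP (T : X → X) : Set (Measure X) :=
  {ν | IsProbabilityMeasure ν ∧ MeasurePreserving T ν ν}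

/-- maximal ergodic average -/
noncomputable def bet (T : X → X) (f : C(X, ℝ)) : ℝ :=
  sSup ((fun ν : Measure X => ∫ x, f x ∂ν) '' InvP T)

lemma cint (f : C(X, ℝ)) (ν : Measure X) [IsFiniteMeasure ν] : Integrable (fun x => f x) ν :=
  f.continuous.integrable_of_hasCompactSupport (HasCompactSupport.of_compactSpace _)

lemma int_le_of_le (f g : C(X, ℝ)) (ν : Measure X) [IsProbabilityMeasure ν] :
    ∫ x, f x ∂ν ≤ ∫ x, g x ∂ν + ‖f - g‖ := by
  have h : ∫ x, f x ∂ν ≤ ∫ x, (g x + ‖f - g‖) ∂ν := by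
    refine integral_mono (cint f ν) ((cint g ν).add (integrable_const _)) fun x => ?_
    have := (f - g).norm_coe_le_norm x
    rw [Real.norm_eq_abs, ContinuousMap.sub_apply] at this
    have := le_abs_self (f x - g x)
    show f x ≤ g x + ‖f - g‖
    linarith
  rw [integral_add (cint g ν) (integrable_const _)] at h
  simpa using h

variable {T : X → X}

lemma bet_bdd (f : C(X, ℝ)) : BddAbove ((fun ν : Measure X => ∫ x, f x ∂ν) '' InvP T) := by
  refine ⟨‖f‖, ?_⟩
  rintro _ ⟨ν, ⟨h1, h2⟩, rfl⟩
  have := int_le_of_le f 0 ν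
  simpa using this

lemma le_bet (f : C(X, ℝ)) {ν : Measure X} (h : ν ∈ InvP T) : ∫ x, f x ∂ν ≤ bet T f :=
  le_csSup (bet_bdd f) ⟨ν, h, rfl⟩

lemma bet_le (hne : (InvP T).Nonempty) (f : C(X, ℝ)) {c : ℝ}
    (h : ∀ ν ∈ InvP T, ∫ x, f x ∂ν ≤ c) : bet T f ≤ c :=
  csSup_le (hne.image _) (by rintro _ ⟨ν, hν, rfl⟩; exact h ν hν)

lemma bet_lip (hne : (InvP T).Nonempty) (f g : C(X, ℝ)) : bet T f ≤ bet T g + ‖f - g‖ := by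
  refine bet_le hne f fun ν hν => ?_
  have := hν.1
  have h1 := int_le_of_le f g ν
  have h2 := le_bet g hν
  linarith

lemma bet_cont (hne : (InvP T).Nonempty) : Continuous (bet T : C(X, ℝ) → ℝ) := by
  refine (LipschitzWith.of_le_add fun f g => ?_ : LipschitzWith 1 _).continuous
  rw [dist_eq_norm]
  exact bet_lip hne f g

lemma bet_convex (hne : (InvP T).Nonempty) : ConvexOn ℝ Set.univ (bet T : C(X, ℝ) → ℝ) := by
  refine ⟨convex_univ, fun f _ g _ a b ha hb _ => ?_⟩
  refine bet_le hne _ fun ν hν => ?_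
  have := hν.1
  have e : ∫ x, (a • f + b • g) x ∂ν = a * ∫ x, f x ∂ν + b * ∫ x, g x ∂ν := by
    simp only [ContinuousMap.add_apply, ContinuousMap.smul_apply, smul_eq_mul]
    rw [integral_add ((cint f ν).const_mul a) ((cint g ν).const_mul b), integral_const_mul,
      integral_const_mul]
  rw [e]
  simp only [smul_eq_mul]
  exact add_le_add (mul_le_mul_of_nonneg_left (le_bet f hν) ha)
    (mul_le_mul_of_nonneg_left (le_bet g hν) hb)

lemma riesz_inv (hT : Continuous T) (hne : (InvP T).Nonempty) (l : C(X, ℝ) →L[ℝ] ℝ)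
    (hl : ∀ h, l h ≤ bet T h) : ∃ μ ∈ InvP T, ∀ h : C(X, ℝ), ∫ x, h x ∂μ = l h := by
  have hpos : ∀ h : C(X, ℝ), (∀ x, 0 ≤ h x) → 0 ≤ l h := by
    intro h hh
    have h1 := hl (-h)
    have h2 : bet T (-h) ≤ 0 := bet_le hne _ fun ν hν => by
      have := hν.1
      exact integral_nonpos fun x => by simpa using hh x
    rw [map_neg] at h1
    linarith
  let Λ0 : C_c(X, ℝ) →ₗ[ℝ] ℝ :=
    { toFun := fun g => l (g : C(X, ℝ))
      map_add' := fun g g' => by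
        rw [← map_add]; rfl
      map_smul' := fun c g => by
        simp only [RingHom.id_apply]
        rw [← map_smul]; rfl }
  let Λ : C_c(X, ℝ) →ₚ[ℝ] ℝ := PositiveLinearMap.mk₀ Λ0 (fun g hg => hpos _ (fun x => hg x))
  have hintg : ∀ h : C(X, ℝ), ∫ x, h x ∂(RealRMK.rieszMeasure Λ) = l h := by
    intro h
    exact RealRMK.integral_rieszMeasure Λ (CompactlySupportedContinuousMap.continuousMapEquiv h)
  set μ := RealRMK.rieszMeasure Λ with hμ
  have hone : l 1 = 1 := by
    apply le_antisymm
    · refine (hl 1).trans (bet_le hne _ fun ν hν => ?_)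
      have := hν.1
      simp
    · have h1 := hl (-1)
      have h2 : bet T (-1 : C(X, ℝ)) ≤ -1 := bet_le hne _ fun ν hν => by
        have := hν.1
        simp
      rw [map_neg] at h1
      linarith
  have hprob : IsProbabilityMeasure μ := by
    have := hintg 1
    rw [hone] at this
    simp [Measure.real] at this
    constructor
    rw [← ENNReal.toReal_eq_one_iff]
    exact this
  refine ⟨μ, ⟨hprob, ⟨hT.measurable, ?_⟩⟩, hintg⟩
  have : IsProbabilityMeasure (μ.map T) := Measure.isProbabilityMeasure_map hT.aemeasurable
  refine ext_of_forall_integral_eq_of_IsFiniteMeasure fun g => ?_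
  rw [integral_map hT.aemeasurable g.continuous.aestronglyMeasurable]
  let g' : C(X, ℝ) := g.toContinuousMap
  let gT : C(X, ℝ) := g'.comp ⟨T, hT⟩
  have key : ∀ h : C(X, ℝ), l (h.comp ⟨T, hT⟩ - h) ≤ 0 := by
    intro h
    refine (hl _).trans (bet_le hne _ fun ν hν => ?_)
    have := hν.1
    have e : ∫ x, h (T x) ∂ν = ∫ x, h x ∂ν := by
      conv_rhs => rw [← hν.2.map_eq]
      rw [integral_map hT.aemeasurable h.continuous.aestronglyMeasurable]
    have := integral_sub (cint (h.comp ⟨T, hT⟩) ν) (cint h ν)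
    simp only [ContinuousMap.sub_apply]
    rw [this]
    simp only [ContinuousMap.comp_apply, ContinuousMap.coe_mk]
    rw [e, sub_self]
  have e1 := key g'
  have e2 := key (-g')
  have e3 : (-g').comp ⟨T, hT⟩ - (-g') = -(g'.comp ⟨T, hT⟩ - g') := by
    ext x; simp; ring
  rw [e3, map_neg] at e2
  rw [map_sub] at e1 e2
  have : l gT = l g' := by simp only [gT]; linarith
  rw [← hintg, ← hintg] at this
  exact this

lemma closed_le (μ ν : Measure X) [IsProbabilityMeasure μ] [IsProbabilityMeasure ν]
    (h : ∀ g : C(X, ℝ), (∀ x, 0 ≤ g x ∧ g x ≤ 1) → ∫ x, g x ∂μ ≤ ∫ x, g x ∂ν + 1/2) :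
    ¬ (μ ⟂ₘ ν) := by
  rintro ⟨s, hs, hμ, hν⟩
  have hμs : μ sᶜ = 1 := by rw [prob_compl_eq_one_iff hs]; exact hμ
  have hreg : μ.InnerRegularCompactLTTop := inferInstance
  obtain ⟨K, hKs, hK, hKm⟩ := hs.compl.exists_isCompact_lt_add (μ := μ) (by simp) (ε := 1/8) (by simp)
  have hνK : ν K = 0 := measure_mono_null hKs hν
  obtain ⟨U, hKU, hU, hUm⟩ := K.exists_isOpen_lt_add (μ := ν) (by simp) (ε := 1/8) (by simp)
  rw [hνK, zero_add] at hUm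
  obtain ⟨g, hg0, hg1, hg⟩ := exists_continuous_zero_one_of_isClosed hU.isClosed_compl hK.isClosed
    (by rw [Set.disjoint_left]; intro x hx hx'; exact hx (hKU hx'))
  have hh := h g (fun x => hg x)
  have h1 : μ.real K ≤ ∫ x, g x ∂μ := by
    rw [← integral_indicator_one hK.measurableSet]
    refine integral_mono ((integrable_const 1).indicator hK.measurableSet) (cint g μ) fun x => ?_
    by_cases hx : x ∈ K
    · simp [hx, hg1 hx]
    · simp [hx, (hg x).1]
  have h2 : ∫ x, g x ∂ν ≤ ν.real U := by
    rw [← integral_indicator_one hU.measurableSet]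
    refine integral_mono (cint g ν) ((integrable_const 1).indicator hU.measurableSet) fun x => ?_
    by_cases hx : x ∈ U
    · simp [hx, (hg x).2]
    · simp [hx, hg0 hx]
  have h3 : ν.real U ≤ 1/8 := by
    have := ENNReal.toReal_mono (by simp) hUm.le
    simpa [Measure.real] using this
  have h4 : 1 ≤ μ.real K + 1/8 := by
    rw [hμs] at hKm
    have := ENNReal.toReal_mono (by simp) hKm.le
    rw [ENNReal.toReal_add (by simp) (by simp)] at this
    simpa [Measure.real] using this
  linarith

end PartI

/-! ### Part 3 -/

open MeasureTheory Topology Filter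
open scoped ENNReal NNReal CompactlySupported
set_option linter.unusedSectionVars false

section PartI
variable {X : Type*} [TopologicalSpace X] [CompactSpace X] [T2Space X]
  [TopologicalSpace.PseudoMetrizableSpace X] [MeasurableSpace X] [BorelSpace X]

lemma ofReal_int_shift (f : C(X, ℝ)) (ν : Measure X) [IsFiniteMeasure ν] :
    ∫⁻ x, ENNReal.ofReal (f x + ‖f‖) ∂ν = ENNReal.ofReal (∫ x, f x ∂ν + ‖f‖ * ν.real Set.univ) := by
  rw [← ofReal_integral_eq_lintegral_ofReal (f := fun x => f x + ‖f‖)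
    ((cint f ν).add (integrable_const _))]
  · rw [integral_add (cint f ν) (integrable_const _)]
    simp [mul_comm]
  · refine ae_of_all _ fun x => ?_
    have := f.norm_coe_le_norm x
    rw [Real.norm_eq_abs] at this
    have := neg_abs_le (f x)
    show 0 ≤ f x + ‖f‖
    linarith

theorem partI {T : X → X} (hT : Continuous T) {Θ : Type*} [MeasurableSpace Θ] (lam : Measure Θ)
    [IsProbabilityMeasure lam] [NullSingletonClass lam] (κ : Θ → Measure X) (hκ : Measurable κ)
    (hp : ∀ t, IsProbabilityMeasure (κ t)) (herg : ∀ t, Ergodic T (κ t)) (f0 : C(X, ℝ))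
    {ε : ℝ} (hdef : ∀ ν ∈ InvP T, ∀ t, ∫ x, f0 x ∂ν ≤ ∫ x, f0 x ∂(κ t) + ε / 2) :
    ∃ f1 : C(X, ℝ), ‖f1 - f0‖ ≤ ε ∧
      ¬ {t | ∀ ν ∈ InvP T, ∫ x, f1 x ∂ν ≤ ∫ x, f1 x ∂(κ t)}.Countable := by
  have hΘ : Nonempty Θ := by
    by_contra h
    rw [not_nonempty_iff] at h
    have h1 : lam Set.univ = 1 := measure_univ
    rw [Set.univ_eq_empty_iff.2 h, measure_empty] at h1
    exact zero_ne_one h1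
  have hinv : ∀ t, κ t ∈ InvP T := fun t => ⟨hp t, (herg t).toMeasurePreserving⟩
  have hne : (InvP T).Nonempty := ⟨κ hΘ.some, hinv _⟩
  set ν0 := lam.bind κ with hν0
  have hκa : AEMeasurable κ lam := hκ.aemeasurable
  have hν0p : IsProbabilityMeasure ν0 := by
    constructor
    rw [hν0, Measure.bind_apply MeasurableSet.univ hκa]
    simp
  have hν0i : MeasurePreserving T ν0 ν0 := by
    refine ⟨hT.measurable, ?_⟩
    ext s hs
    rw [Measure.map_apply hT.measurable hs, Measure.bind_apply (hT.measurable hs) hκa,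
      Measure.bind_apply hs hκa]
    refine lintegral_congr fun t => ?_
    exact (herg t).toMeasurePreserving.measure_preimage hs.nullMeasurableSet
  have hν0I : ν0 ∈ InvP T := ⟨hν0p, hν0i⟩
  -- the deficit at `f0`
  have hbind : ∀ (f : C(X, ℝ)), ∫⁻ x, ENNReal.ofReal (f x + ‖f‖) ∂ν0
      = ∫⁻ t, ENNReal.ofReal (∫ x, f x ∂(κ t) + ‖f‖) ∂lam := by
    intro f
    rw [hν0, Measure.lintegral_bind hκa (by fun_prop)]
    refine lintegral_congr fun t => ?_
    have := hp t
    rw [ofReal_int_shift]; simp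
  have hdef0 : bet T f0 - ∫ x, f0 x ∂ν0 ≤ ε / 2 := by
    have h1 : ∀ t, bet T f0 - ε / 2 ≤ ∫ x, f0 x ∂(κ t) := fun t => by
      have := bet_le hne f0 (fun ν hν => hdef ν hν t)
      linarith
    have h2 := hbind f0
    rw [ofReal_int_shift] at h2
    simp only [probReal_univ, mul_one] at h2
    have h3 : ENNReal.ofReal (bet T f0 - ε / 2 + ‖f0‖) ≤ ENNReal.ofReal (∫ x, f0 x ∂ν0 + ‖f0‖) := by
      rw [h2]
      calc _ = ∫⁻ t, ENNReal.ofReal (bet T f0 - ε / 2 + ‖f0‖) ∂lam := by simp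
        _ ≤ _ := lintegral_mono fun t => ENNReal.ofReal_le_ofReal (by linarith [h1 t])
    have h4 : 0 ≤ ∫ x, f0 x ∂ν0 + ‖f0‖ := by
      have := int_le_of_le 0 f0 ν0
      simpa using this
    rw [ENNReal.ofReal_le_ofReal_iff h4] at h3
    linarith
  -- integration as a continuous linear functional
  have hLc : Continuous (fun f : C(X, ℝ) => ∫ x, f x ∂ν0) := by
    refine (LipschitzWith.of_le_add fun f g => ?_ : LipschitzWith 1 _).continuous
    rw [dist_eq_norm]
    exact int_le_of_le f g ν0
  obtain ⟨f1, hf1, hmin⟩ := ekeland_half (fun f : C(X, ℝ) => bet T f - ∫ x, f x ∂ν0)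
    ((bet_cont hne).sub hLc) (fun f => by have := le_bet f hν0I; linarith) f0
  refine ⟨f1, ?_, ?_⟩
  · have := le_bet f1 hν0I
    rw [dist_comm, dist_eq_norm] at hf1
    linarith
  -- the maximizing measure near ν0
  have hLadd : ∀ f g : C(X, ℝ), ∫ x, (f + g) x ∂ν0 = ∫ x, f x ∂ν0 + ∫ x, g x ∂ν0 := fun f g => by
    simp only [ContinuousMap.add_apply]
    exact integral_add (cint f ν0) (cint g ν0)
  have hLsmul : ∀ (c : ℝ) (f : C(X, ℝ)), ∫ x, (c • f) x ∂ν0 = c * ∫ x, f x ∂ν0 := fun c f => by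
    simp only [ContinuousMap.smul_apply, smul_eq_mul]
    exact integral_const_mul _ _
  obtain ⟨l, hl⟩ := sandwich_hb (fun h : C(X, ℝ) => bet T (f1 + h) - bet T f1)
    (fun h : C(X, ℝ) => ∫ x, h x ∂ν0 - ‖h‖ / 2)
    (((bet_cont hne).comp (continuous_const.add continuous_id)).sub continuous_const)
    (hLc.sub (by fun_prop))
    (by
      refine ⟨convex_univ, fun f _ g _ a b ha hb hab => ?_⟩
      have := (bet_convex hne).2 (Set.mem_univ (f1 + f)) (Set.mem_univ (f1 + g)) ha hb hab
      have e : a • (f1 + f) + b • (f1 + g) = f1 + (a • f + b • g) := by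
        have : f1 = (a + b) • f1 := by rw [hab, one_smul]
        conv_rhs => rw [this]
        rw [add_smul, smul_add, smul_add]; abel
      rw [e] at this
      simp only [smul_eq_mul] at this ⊢
      have e2 : bet T f1 = a * bet T f1 + b * bet T f1 := by rw [← add_mul, hab, one_mul]
      linarith)
    (by
      refine ⟨convex_univ, fun f _ g _ a b ha hb hab => ?_⟩
      simp only [smul_eq_mul]
      rw [hLadd, hLsmul, hLsmul]
      have := norm_add_le (a • f) (b • g)
      rw [norm_smul, norm_smul, Real.norm_of_nonneg ha, Real.norm_of_nonneg hb] at this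
      linarith)
    (by simp) (by simp)
    (by
      intro h
      have := hmin (f1 + h)
      rw [hLadd, dist_eq_norm] at this
      have e : f1 - (f1 + h) = -h := by abel
      rw [e, norm_neg] at this
      linarith)
  obtain ⟨μ, hμ, hμl⟩ := riesz_inv hT hne l (fun h => by
    refine (hl h).2.trans ?_
    have h1 : bet T (f1 + h) ≤ bet T f1 + bet T h := by
      refine bet_le hne _ fun ν hν => ?_
      have := hν.1
      simp only [ContinuousMap.add_apply]
      rw [integral_add (cint f1 ν) (cint h ν)]
      linarith [le_bet f1 hν, le_bet h hν]
    linarith)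
  have hμp := hμ.1
  have hμi := hμ.2
  have hμmax : ∫ x, f1 x ∂μ = bet T f1 := by
    apply le_antisymm (le_bet f1 hμ)
    have h1 := (hl (-f1)).2
    rw [map_neg, ← hμl] at h1
    have h2 : bet T (f1 + -f1) ≤ 0 := bet_le hne _ fun ν hν => by simp
    linarith
  have hns : ¬ (μ ⟂ₘ ν0) := by
    apply closed_le
    intro g hg
    have h1 := (hl (-g)).1
    rw [map_neg, ← hμl, norm_neg] at h1
    have h2 : ∫ x, (-g) x ∂ν0 = - ∫ x, g x ∂ν0 := by
      simp only [ContinuousMap.neg_apply]; exact integral_neg _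
    have h3 : ‖g‖ ≤ 1 := (ContinuousMap.norm_le _ zero_le_one).2 fun x => by
      rw [Real.norm_eq_abs, abs_le]; constructor <;> linarith [hg x]
    linarith
  -- decomposition
  set k := μ.rnDeriv ν0 with hk
  have hkm : Measurable k := Measure.measurable_rnDeriv _ _
  set μa := ν0.withDensity k with hμa
  set μs := μ.singularPart ν0 with hμs
  have hai : MeasurePreserving T μa μa := hμi.withDensity_rnDeriv hν0i
  have hsi : MeasurePreserving T μs μs := hμi.singularPart hν0i
  have hsum : μ = μs + μa := Measure.haveLebesgueDecomposition_add μ ν0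
  have hkinv : k ∘ T =ᵐ[ν0] k := hμi.rnDeriv_comp_aeEq hν0i
  have hafin : IsFiniteMeasure μa := inferInstance
  have hsfin : IsFiniteMeasure μs := inferInstance
  have hle : ∀ ρ : Measure X, IsFiniteMeasure ρ → MeasurePreserving T ρ ρ →
      ∫ x, f1 x ∂ρ ≤ bet T f1 * ρ.real Set.univ := by
    intro ρ hρ hρi
    by_cases h0 : ρ = 0
    · simp [h0]
    have hm : ρ Set.univ ≠ 0 := by simpa using h0
    have hmt : ρ Set.univ ≠ ∞ := measure_ne_top _ _
    have hI : (ρ Set.univ)⁻¹ • ρ ∈ InvP T := by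
      refine ⟨⟨?_⟩, hρi.measurable, ?_⟩
      · simp [ENNReal.inv_mul_cancel hm hmt]
      · rw [Measure.map_smul, hρi.map_eq]
    have := le_bet f1 hI
    rw [integral_smul_measure] at this
    simp only [ENNReal.toReal_inv, smul_eq_mul] at this
    have hpos : 0 < (ρ Set.univ).toReal := ENNReal.toReal_pos hm hmt
    rw [inv_mul_le_iff₀ hpos] at this
    simp only [Measure.real]
    linarith
  have haeq : ∫ x, f1 x ∂μa = bet T f1 * μa.real Set.univ := by
    have h1 := hle μa hafin hai
    have h2 := hle μs hsfin hsi
    have h3 : ∫ x, f1 x ∂μ = ∫ x, f1 x ∂μs + ∫ x, f1 x ∂μa := by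
      conv_lhs => rw [hsum]
      exact integral_add_measure (cint f1 μs) (cint f1 μa)
    have h4 : (1:ℝ) = μs.real Set.univ + μa.real Set.univ := by
      rw [← measureReal_add_apply, ← hsum]; simp
    have h5 : bet T f1 = bet T f1 * μs.real Set.univ + bet T f1 * μa.real Set.univ := by
      rw [← mul_add, ← h4, mul_one]
    linarith
  -- constants
  have hkt : ∀ᵐ t ∂lam, ∃ c, k =ᵐ[κ t] fun _ => c := by
    filter_upwards [Measure.ae_ae_of_ae_bind hκa hkinv] with t ht
    exact (herg t).ae_eq_const_of_ae_eq_comp_ae hkm.aestronglyMeasurable ht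
  have hFm : Measurable (fun x => ENNReal.ofReal (f1 x + ‖f1‖)) := by fun_prop
  set K : Θ → ℝ≥0∞ := fun t => ∫⁻ x, k x ∂(κ t) with hK
  have hKm : Measurable K := (Measure.measurable_lintegral hkm).comp hκ
  have hKint : ∫⁻ t, K t ∂lam = μa Set.univ := by
    rw [hμa, withDensity_apply _ MeasurableSet.univ, Measure.restrict_univ, hν0,
      Measure.lintegral_bind hκa hkm.aemeasurable]
  set F : Θ → ℝ≥0∞ := fun t => ENNReal.ofReal (∫ x, f1 x ∂(κ t) + ‖f1‖) with hF
  have hFint : ∀ t, ∫⁻ x, ENNReal.ofReal (f1 x + ‖f1‖) ∂(κ t) = F t := by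
    intro t
    have := hp t
    rw [ofReal_int_shift]; simp [hF]
  have hFmeas : Measurable F := by
    have : F = fun t => ∫⁻ x, ENNReal.ofReal (f1 x + ‖f1‖) ∂(κ t) := by ext t; rw [hFint]
    rw [this]
    exact (Measure.measurable_lintegral hFm).comp hκ
  set B : ℝ≥0∞ := ENNReal.ofReal (bet T f1 + ‖f1‖) with hB
  have hB0 : 0 ≤ bet T f1 + ‖f1‖ := by
    have h1 := int_le_of_le 0 f1 μ
    simp at h1
    linarith
  have hFB : ∀ t, F t ≤ B := fun t =>
    ENNReal.ofReal_le_ofReal (by linarith [le_bet f1 (hinv t)])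
  have hmain : ∫⁻ t, F t * K t ∂lam = ∫⁻ t, B * K t ∂lam := by
    rw [lintegral_const_mul _ hKm, hKint]
    have e1 : ∫⁻ x, ENNReal.ofReal (f1 x + ‖f1‖) ∂μa = B * μa Set.univ := by
      rw [ofReal_int_shift, haeq, ← add_mul, ENNReal.ofReal_mul hB0]
      simp [Measure.real, hB]
    rw [← e1, hμa, lintegral_withDensity_eq_lintegral_mul _ hkm hFm, hν0,
      Measure.lintegral_bind hκa (hkm.mul hFm).aemeasurable]
    refine lintegral_congr_ae ?_
    filter_upwards [hkt] with t ⟨c, hc⟩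
    have := hp t
    have e2 : K t = c := by
      simp only [hK]; rw [lintegral_congr_ae hc]; simp
    rw [e2, ← hFint]
    have : ∫⁻ x, (k * fun x => ENNReal.ofReal (f1 x + ‖f1‖)) x ∂(κ t)
        = ∫⁻ x, c * ENNReal.ofReal (f1 x + ‖f1‖) ∂(κ t) := by
      refine lintegral_congr_ae ?_
      filter_upwards [hc] with x hx
      simp [hx]
    rw [this, lintegral_const_mul _ hFm, mul_comm]
  have hfin : ∫⁻ t, F t * K t ∂lam ≠ ∞ := by
    rw [hmain, lintegral_const_mul _ hKm, hKint]
    exact ENNReal.mul_ne_top (by simp [hB]) (measure_ne_top _ _)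
  have hae : (fun t => F t * K t) =ᵐ[lam] fun t => B * K t :=
    ae_eq_of_ae_le_of_lintegral_le (ae_of_all _ fun t => mul_le_mul_left (hFB t) _) hfin
      (hKm.const_mul B).aemeasurable hmain.ge
  have hKfin : ∀ᵐ t ∂lam, K t < ∞ := ae_lt_top hKm (by rw [hKint]; exact measure_ne_top _ _)
  intro hcount
  have hnull := hcount.measure_zero lam
  have hK0 : K =ᵐ[lam] 0 := by
    filter_upwards [hae, hKfin, measure_eq_zero_iff_ae_notMem.1 hnull] with t h1 h2 h3
    by_contra h0
    apply h3
    have h4 : F t = B := (ENNReal.mul_left_inj h0 h2.ne).1 h1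
    intro ν hν
    have h5 : bet T f1 + ‖f1‖ ≤ ∫ x, f1 x ∂(κ t) + ‖f1‖ := by
      have h6 : 0 ≤ ∫ x, f1 x ∂(κ t) + ‖f1‖ := by
        have := hp t
        have := int_le_of_le 0 f1 (κ t)
        simpa using this
      rw [← ENNReal.ofReal_le_ofReal_iff h6]
      exact h4.ge
    linarith [le_bet f1 hν]
  have hzero : μa Set.univ = 0 := by
    rw [← hKint, lintegral_congr_ae hK0]; simp
  apply hns
  have : μa = 0 := by simpa using hzero
  rw [this, add_zero] at hsum
  rw [hsum]
  exact Measure.mutuallySingular_singularPart _ _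

end PartI

/-! ### Part 4 -/

open MeasureTheory Topology Filter ProbabilityTheory
open scoped ENNReal NNReal symmDiff

lemma shift_iterate {A : Type*} (x : ℤ → A) (n : ℕ) : shift^[n] x = fun i => x (i + n) := by
  induction n generalizing x with
  | zero => simp
  | succ n ih =>
    rw [Function.iterate_succ_apply, ih]
    funext i; simp only [shift]; congr 1; push_cast; ring

section IID
variable {A : Type*} [MeasurableSpace A]

noncomputable def iid (p : Measure A) [IsProbabilityMeasure p] : Measure (ℤ → A) :=
  Measure.infinitePi (fun _ : ℤ => p)

instance (p : Measure A) [IsProbabilityMeasure p] : IsProbabilityMeasure (iid p) := by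
  unfold iid; infer_instance

lemma iid_reindex (p : Measure A) [IsProbabilityMeasure p] (e : ℤ ≃ ℤ) :
    MeasurePreserving (fun (x : ℤ → A) i => x (e i)) (iid p) (iid p) := by
  have hm : Measurable (fun (x : ℤ → A) i => x (e i)) :=
    measurable_pi_lambda _ fun i => measurable_pi_apply _
  refine ⟨hm, ?_⟩
  unfold iid
  refine Measure.eq_infinitePi _ fun s t ht => ?_
  rw [Measure.map_apply hm (MeasurableSet.pi s.countable_toSet fun i _ => ht i)]
  have : (fun (x : ℤ → A) i => x (e i)) ⁻¹' (Set.pi s t)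
      = Set.pi (s.map e.toEmbedding : Finset ℤ) (fun j => t (e.symm j)) := by
    ext x
    simp only [Set.mem_preimage, Set.mem_pi, Finset.coe_map, Set.mem_image]
    constructor
    · rintro h _ ⟨i, hi, rfl⟩
      simpa using h i hi
    · intro h i hi
      simpa using h (e i) ⟨i, hi, rfl⟩
  rw [this, Measure.infinitePi_pi _ (fun i _ => ht _), Finset.prod_map]
  simp

lemma iid_shift (p : Measure A) [IsProbabilityMeasure p] :
    MeasurePreserving (shift : (ℤ → A) → _) (iid p) (iid p) :=
  iid_reindex p (Equiv.addRight 1)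

lemma iid_iIndep (p : Measure A) [IsProbabilityMeasure p] :
    iIndepFun (fun (i : ℤ) (x : ℤ → A) => x i) (iid p) := by
  rw [iIndepFun_iff_map_fun_eq_infinitePi_map (fun i => measurable_pi_apply i)]
  have h : ∀ i : ℤ, Measure.map (fun x : ℤ → A => x i) (iid p) = p := fun i =>
    (measurePreserving_eval_infinitePi (fun _ : ℤ => p) i).map_eq
  simp only [h]
  exact Measure.map_id

lemma iid_mix (p : Measure A) [IsProbabilityMeasure p] {C : Set (ℤ → A)}
    (hC : C ∈ measurableCylinders (fun _ : ℤ => A)) :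
    ∃ n : ℕ, (iid p) (C ∩ shift^[n] ⁻¹' C) = iid p C * iid p C := by
  obtain ⟨s, S, hS, rfl⟩ := (mem_measurableCylinders C).1 hC
  obtain ⟨b, hb⟩ : ∃ b : ℕ, ∀ i ∈ s, |i| ≤ b := by
    refine ⟨∑ i ∈ s, i.natAbs, fun i hi => ?_⟩
    have := Finset.single_le_sum (f := fun i : ℤ => i.natAbs) (fun _ _ => Nat.zero_le _) hi
    rw [abs_le]
    omega
  let n := 2 * b + 1
  refine ⟨n, ?_⟩
  let e : ℤ ≃ ℤ := Equiv.addRight (n : ℤ)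
  let T := s.map e.toEmbedding
  have hd : Disjoint s T := by
    rw [Finset.disjoint_left]
    intro i hi hT
    simp only [T, Finset.mem_map] at hT
    obtain ⟨j, hj, rfl⟩ := hT
    have h1 := hb _ hi
    have h2 := hb _ hj
    simp only [e, Equiv.coe_toEmbedding, Equiv.coe_addRight, abs_le] at h1 h2
    simp only [n] at h1
    push_cast at h1
    omega
  have hind := (iid_iIndep p).indepFun_finset s T hd (fun i => measurable_pi_apply i)
  let g : (T → A) → (s → A) := fun y i => y ⟨(i : ℤ) + n, by
    simp only [T, Finset.mem_map]; exact ⟨i, i.2, rfl⟩⟩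
  have hg : Measurable g := measurable_pi_lambda _ fun i => measurable_pi_apply _
  have h2 := hind.measure_inter_preimage_eq_mul S (g ⁻¹' S) hS (hg hS)
  have e1 : (fun (a : ℤ → A) (i : s) => a i) ⁻¹' S = cylinder s S := rfl
  have e2 : (fun (a : ℤ → A) (i : T) => a i) ⁻¹' (g ⁻¹' S) = shift^[n] ⁻¹' (cylinder s S) := by
    ext x
    simp only [Set.mem_preimage, shift_iterate]
    rfl
  rw [e1, e2] at h2
  rw [h2, ((iid_shift p).iterate n).measure_preimage (hS.cylinder s).nullMeasurableSet]

lemma iid_ergodic (p : Measure A) [IsProbabilityMeasure p] :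
    Ergodic (shift : (ℤ → A) → _) (iid p) := by
  refine ⟨iid_shift p, ⟨fun {E} hE hinv => ?_⟩⟩
  have hinv' : ∀ n : ℕ, shift^[n] ⁻¹' E = E := fun n => by
    induction n with
    | zero => rfl
    | succ n ih => rw [Function.iterate_succ', Set.preimage_comp, hinv, ih]
  have key : (iid p).real E = (iid p).real E * (iid p).real E := by
    refine eq_of_abs_sub_le_all fun ε hε => ?_
    obtain ⟨C, hC, hCE⟩ := exists_measure_symmDiff_lt_of_generateFrom_isSetRing (μ := iid p)
      (C := measurableCylinders (fun _ : ℤ => A)) isSetRing_measurableCylinders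
      ⟨{Set.univ}, Set.countable_singleton _, by
        simpa using univ_mem_measurableCylinders (fun _ : ℤ => A), by simp⟩
      (generateFrom_measurableCylinders).symm hE
      (ε := ENNReal.ofReal (ε / 4)) (by simpa using by linarith)
    obtain ⟨n, hn⟩ := iid_mix p hC
    have hCm : MeasurableSet C := MeasurableSet.of_mem_measurableCylinders hC
    have hTm : Measurable (shift^[n] : (ℤ → A) → _) := ((iid_shift p).iterate n).measurable
    have hr : (iid p).real (C ∆ E) ≤ ε / 4 := by
      rw [Measure.real]
      exact ENNReal.toReal_le_of_le_ofReal (by linarith) hCE.le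
    have hr2 : (iid p).real ((shift^[n] ⁻¹' C) ∆ E) ≤ ε / 4 := by
      have : (shift^[n] ⁻¹' C) ∆ E = shift^[n] ⁻¹' (C ∆ E) := by
        rw [Set.preimage_symmDiff, hinv']
      rw [this, Measure.real, ((iid_shift p).iterate n).measure_preimage
        (hCm.symmDiff hE).nullMeasurableSet]
      exact hr
    have hn' : (iid p).real (C ∩ shift^[n] ⁻¹' C) = (iid p).real C * (iid p).real C := by
      simp only [Measure.real, hn, ENNReal.toReal_mul]
    have a1 : |(iid p).real C - (iid p).real E| ≤ ε / 4 :=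
      (abs_measureReal_sub_le_measureReal_symmDiff hCm.nullMeasurableSet hE.nullMeasurableSet).trans hr
    have a2 : |(iid p).real (C ∩ shift^[n] ⁻¹' C) - (iid p).real E| ≤ ε / 4 + ε / 4 := by
      refine (abs_measureReal_sub_le_measureReal_symmDiff (hCm.inter (hTm hCm)).nullMeasurableSet
        hE.nullMeasurableSet).trans ?_
      refine le_trans ?_ (add_le_add hr hr2)
      refine le_trans (measureReal_mono ?_ ?_) (measureReal_union_le _ _)
      · intro x hx
        simp only [Set.mem_symmDiff, Set.mem_inter_iff, Set.mem_union] at hx ⊢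
        tauto
      · exact measure_ne_top _ _
    have b1 : (iid p).real C ≤ 1 := measureReal_le_one
    have b2 : (iid p).real E ≤ 1 := measureReal_le_one
    have b3 : 0 ≤ (iid p).real C := measureReal_nonneg
    have b4 : 0 ≤ (iid p).real E := measureReal_nonneg
    rw [hn'] at a2
    rw [abs_le] at a1 a2 ⊢
    constructor <;> nlinarith
  have h01 : (iid p).real E = 0 ∨ (iid p).real E = 1 := by
    have : (iid p).real E * ((iid p).real E - 1) = 0 := by linarith
    rcases mul_eq_zero.1 this with h | h
    · exact Or.inl h
    · exact Or.inr (by linarith)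
  rw [eventuallyConst_set]
  rcases h01 with h | h
  · right
    rw [measureReal_eq_zero_iff] at h
    exact measure_eq_zero_iff_ae_notMem.1 h |>.mono fun x hx => by simpa using hx
  · left
    have : (iid p) E = 1 := by
      rw [Measure.real] at h
      rw [← ENNReal.ofReal_toReal (measure_ne_top (iid p) E), h]; simp
    exact (prob_compl_eq_zero_iff hE).2 this |> fun h => by
      filter_upwards [measure_eq_zero_iff_ae_notMem.1 h] with x hx
      simpa using hx

end IID

/-! ### Part 5 -/

open MeasureTheory Topology Filter ProbabilityTheory
open scoped ENNReal NNReal symmDiff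

section IID2
variable {A : Type*} [MeasurableSpace A]

lemma iid_box (p : Measure A) [IsProbabilityMeasure p] (s : Finset ℤ) (t : ℤ → Set A)
    (ht : ∀ i ∈ s, MeasurableSet (t i)) :
    iid p (Set.pi s t) = ∏ i ∈ s, p (t i) := Measure.infinitePi_pi _ ht

lemma iid_inj {p q : Measure A} [IsProbabilityMeasure p] [IsProbabilityMeasure q]
    (h : iid p = iid q) : p = q := by
  have h1 := (measurePreserving_eval_infinitePi (fun _ : ℤ => p) 0).map_eq
  have h2 := (measurePreserving_eval_infinitePi (fun _ : ℤ => q) 0).map_eq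
  have h' : Measure.infinitePi (fun _ : ℤ => p) = Measure.infinitePi (fun _ : ℤ => q) := h
  rw [← h1, ← h2, h']

lemma iid_measurable {Θ : Type*} [MeasurableSpace Θ] (p : Θ → Measure A)
    [∀ t, IsProbabilityMeasure (p t)] (hp : Measurable p) : Measurable (fun t => iid (p t)) := by
  refine Measurable.measure_of_isPiSystem_of_isProbabilityMeasure
    (S := squareCylinders (fun _ : ℤ => {s : Set A | MeasurableSet s}))
    (generateFrom_squareCylinders).symm
    (isPiSystem_squareCylinders (fun _ => MeasurableSpace.isPiSystem_measurableSet)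
      (fun _ => MeasurableSet.univ)) ?_
  rintro _ ⟨s, t, ht, rfl⟩
  have ht' : ∀ i, MeasurableSet (t i) := fun i => ht i (Set.mem_univ i)
  have : ∀ θ, iid (p θ) (Set.pi s t) = ∏ i ∈ s, p θ (t i) := fun θ => iid_box _ s t fun i _ => ht' i
  simp only [this]
  exact Finset.measurable_prod _ fun i _ => (Measure.measurable_coe (ht' i)).comp hp

lemma iid_word {B : Type*} [MeasurableSpace B] [MeasurableSingletonClass B] (p : Measure B)
    [IsProbabilityMeasure p] (n : ℕ) (w : Fin n → B) (j : ℤ) :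
    iid p {y | ∀ i : Fin n, y (j + (i : ℕ)) = w i} = ∏ i, p {w i} := by
  classical
  let e : Fin n ↪ ℤ := ⟨fun i => j + (i : ℕ), fun a b h => by
    simp only at h; exact Fin.ext (by omega)⟩
  by_cases hn : Nonempty (Fin n)
  · let f := Function.invFun e
    have hf : ∀ i, f (e i) = i := Function.leftInverse_invFun e.injective
    have : {y : ℤ → B | ∀ i : Fin n, y (j + (i : ℕ)) = w i}
        = Set.pi (Finset.univ.map e : Finset ℤ) (fun k => {w (f k)}) := by
      ext y
      simp only [Set.mem_setOf_eq, Set.mem_pi, Finset.coe_map, Finset.coe_univ, Set.image_univ,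
        Set.mem_range, Set.mem_singleton_iff]
      constructor
      · rintro h _ ⟨i, rfl⟩
        rw [hf]; exact h i
      · intro h i
        have := h (e i) ⟨i, rfl⟩
        rw [hf] at this; exact this
    rw [this, iid_box _ _ _ fun i _ => measurableSet_singleton _, Finset.prod_map]
    simp [hf]
  · haveI : IsEmpty (Fin n) := not_nonempty_iff.1 hn
    simp

lemma isBernoulli_of_factor {X : Type*} [MeasurableSpace X] [Fintype A]
    [DiscreteMeasurableSpace A] (T : X → X)
    (p : Measure A) [IsProbabilityMeasure p] (Ψ : (ℤ → A) → X) (Θ : X → (ℤ → A))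
    (hΨ : Measurable Ψ) (hΘ : Measurable Θ) (hT : Measurable T) (hinv : ∀ x, Θ (Ψ x) = x)
    (heq : ∀ x, Ψ (shift x) = T (Ψ x)) (hX : MeasurableSet {x : X | Ψ (Θ x) = x}) :
    IsBernoulli T (Measure.map Ψ (iid p)) := by
  classical
  have hne : Nonempty A := by
    by_contra h
    haveI := not_nonempty_iff.1 h
    have h0 : p = 0 := Measure.eq_zero_of_isEmpty p
    have h1 := measure_univ (μ := p)
    rw [h0] at h1
    simp at h1
  let enc : A → ℕ := fun b => (Fintype.equivFin A b : ℕ)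
  have henc : Function.Injective enc := fun a b h =>
    (Fintype.equivFin A).injective (Fin.ext h)
  let dec : ℕ → A := Function.invFun enc
  have hdec : ∀ b, dec (enc b) = b := Function.leftInverse_invFun henc
  have mdec : Measurable dec := measurable_from_top
  have menc : Measurable enc := measurable_of_finite _
  let Enc : (ℤ → A) → (ℤ → ℕ) := fun x i => enc (x i)
  let Dec : (ℤ → ℕ) → (ℤ → A) := fun y i => dec (y i)
  have mEnc : Measurable Enc := measurable_pi_lambda _ fun i => menc.comp (measurable_pi_apply i)
  have mDec : Measurable Dec := measurable_pi_lambda _ fun i => mdec.comp (measurable_pi_apply i)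
  have hDE : ∀ x, Dec (Enc x) = x := fun x => funext fun i => hdec _
  haveI : IsProbabilityMeasure (p.map enc) := Measure.isProbabilityMeasure_map menc.aemeasurable
  have hmap : Measure.map Enc (iid p) = iid (p.map enc) :=
    Measure.infinitePi_map_pi (fun _ : ℤ => p) (fun _ => menc)
  refine ⟨fun n => p.map enc {n}, iid (p.map enc), ?_, inferInstance, fun n w j => iid_word _ n w j,
    fun x => Enc (Θ x), fun y => Ψ (Dec y), mEnc.comp hΘ, hΨ.comp mDec, ?_, ?_, ?_, ?_, ?_⟩
  · have := Measure.tsum_indicator_apply_singleton (p.map enc) Set.univ MeasurableSet.univ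
    simpa using this
  · rw [Measure.map_map (g := fun x => Enc (Θ x)) (mEnc.comp hΘ) hΨ, ← hmap]
    congr 1
    funext x
    simp [hinv]
  · rw [← hmap, Measure.map_map (g := fun y => Ψ (Dec y)) (hΨ.comp mDec) mEnc]
    congr 1
    funext x
    simp [hDE]
  · simp only [hDE]
    rw [ae_map_iff hΨ.aemeasurable hX]
    exact Eventually.of_forall fun x => by rw [hinv]
  · simp only [hinv]
    rw [← hmap, ae_map_iff mEnc.aemeasurable]
    · exact Eventually.of_forall fun x => by rw [hDE]
    · have : {y : ℤ → ℕ | Enc (Dec y) = y} = ⋂ i : ℤ, (fun y : ℤ → ℕ => y i) ⁻¹' {n | enc (dec n) = n} := by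
        ext y; simp [Enc, Dec, funext_iff]
      rw [this]
      exact MeasurableSet.iInter fun i => measurable_pi_apply i (MeasurableSet.of_discrete)
  · rw [ae_map_iff hΨ.aemeasurable]
    · exact Eventually.of_forall fun x => by
        simp only [← heq, hinv]; rfl
    · have : {x : X | Enc (Θ (T x)) = shift (Enc (Θ x))}
          = ⋂ i : ℤ, (fun x => (Enc (Θ (T x)) i, Enc (Θ x) (i+1))) ⁻¹' {q : ℕ × ℕ | q.1 = q.2} := by
        ext y; simp [shift, funext_iff]
      rw [this]
      refine MeasurableSet.iInter fun i => Measurable.prodMk ?_ ?_ (MeasurableSet.of_discrete)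
      · exact (measurable_pi_apply i).comp (mEnc.comp (hΘ.comp hT))
      · exact (measurable_pi_apply _).comp (mEnc.comp hΘ)

/-! the letter distributions -/
variable [Fintype A] [DecidableEq A] [MeasurableSingletonClass A]

noncomputable def qw (a : A) (δ : ℝ) (b : A) : ℝ :=
  if b = a then 1 - δ else δ / ((Fintype.card A : ℝ) - 1)

noncomputable def pw (a : A) (δ : ℝ) : Measure A :=
  ∑ b : A, ENNReal.ofReal (qw a δ b) • Measure.dirac b

lemma pw_apply (a : A) (δ : ℝ) (b : A) : pw a δ {b} = ENNReal.ofReal (qw a δ b) := by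
  simp only [pw, Measure.coe_finset_sum, Finset.sum_apply, Measure.smul_apply, smul_eq_mul]
  rw [Finset.sum_eq_single b]
  · simp
  · intro c _ hc; simp [hc]
  · simp

lemma qw_nonneg (a : A) {δ : ℝ} (h0 : 0 < δ) (h1 : δ < 1) (hc : 2 ≤ Fintype.card A) (b : A) :
    0 < qw a δ b := by
  have : (2 : ℝ) ≤ Fintype.card A := by exact_mod_cast hc
  unfold qw
  split_ifs
  · linarith
  · apply div_pos h0; linarith

lemma pw_prob (a : A) {δ : ℝ} (h0 : 0 < δ) (h1 : δ < 1) (hc : 2 ≤ Fintype.card A) :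
    IsProbabilityMeasure (pw a δ) := by
  constructor
  have h2 : (2 : ℝ) ≤ Fintype.card A := by exact_mod_cast hc
  simp only [pw, Measure.coe_finset_sum, Finset.sum_apply, Measure.smul_apply, smul_eq_mul,
    measure_univ, mul_one]
  rw [← ENNReal.ofReal_sum_of_nonneg fun b _ => (qw_nonneg a h0 h1 hc b).le]
  rw [← Finset.add_sum_erase _ _ (Finset.mem_univ a)]
  have : ∀ b ∈ Finset.univ.erase a, qw a δ b = δ / ((Fintype.card A : ℝ) - 1) := fun b hb => by
    simp [qw, Finset.ne_of_mem_erase hb]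
  rw [Finset.sum_congr rfl this, Finset.sum_const, Finset.card_erase_of_mem (Finset.mem_univ a)]
  simp only [qw, if_true, Finset.card_univ, nsmul_eq_mul]
  rw [Nat.cast_sub (by omega)]
  have h3 : (Fintype.card A : ℝ) - 1 ≠ 0 := by linarith
  push_cast
  rw [mul_div_cancel₀ _ h3]
  simp

lemma pw_compl (a : A) {δ : ℝ} (h0 : 0 < δ) (h1 : δ < 1) (hc : 2 ≤ Fintype.card A) :
    pw a δ {a}ᶜ = 1 - ENNReal.ofReal (1 - δ) := by
  haveI := pw_prob a h0 h1 hc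
  rw [prob_compl_eq_one_sub (measurableSet_singleton a), pw_apply]
  simp [qw]

end IID2

/-! ### Part 6 -/

open MeasureTheory Topology Filter ProbabilityTheory
open scoped ENNReal NNReal symmDiff

/-! ### heights and matching -/

def ht (c : ℤ → ℤ) (n : ℤ) : ℤ :=
  (∑ k ∈ Finset.range n.toNat, c k) - ∑ k ∈ Finset.range (-n).toNat, c (-(k : ℤ) - 1)

lemma ht_succ (c : ℤ → ℤ) (n : ℤ) : ht c (n + 1) = ht c n + c n := by
  unfold ht
  rcases lt_or_ge n 0 with h | h
  · have e1 : (-n).toNat = (-(n + 1)).toNat + 1 := by omega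
    have e2 : (n + 1).toNat = 0 := by omega
    have e3 : n.toNat = 0 := by omega
    rw [e1, e2, e3, Finset.sum_range_succ]
    have : -((-(n + 1)).toNat : ℤ) - 1 = n := by omega
    rw [this]; simp
  · have e1 : (n + 1).toNat = n.toNat + 1 := by omega
    have e2 : (-(n + 1)).toNat = 0 := by omega
    have e3 : (-n).toNat = 0 := by omega
    rw [e1, e2, e3, Finset.sum_range_succ]
    have : ((n.toNat : ℕ) : ℤ) = n := by omega
    rw [this]; simp

def Mat (c : ℤ → ℤ) (i j : ℤ) : Prop :=
  i < j ∧ ht c (j + 1) = ht c i ∧ ∀ m, i < m → m ≤ j → ht c i < ht c m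

/-- any function with the right increments computes matching -/
lemma ht_pot {c H : ℤ → ℤ} {i j : ℤ} (hH : ∀ n, i ≤ n → n ≤ j → H (n + 1) = H n + c n) :
    ∀ m, i ≤ m → m ≤ j + 1 → H m - H i = ht c m - ht c i := by
  intro m hm
  induction m, hm using Int.le_induction with
  | base => simp
  | succ m hm ih =>
    intro h
    have := ih (by omega)
    rw [hH m hm (by omega), ht_succ]; omega

lemma Mat_iff_pot {c H : ℤ → ℤ} {i j : ℤ} (hH : ∀ n, i ≤ n → n ≤ j → H (n + 1) = H n + c n) :
    Mat c i j ↔ i < j ∧ H (j + 1) = H i ∧ ∀ m, i < m → m ≤ j → H i < H m := by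
  have h := ht_pot hH
  unfold Mat
  refine and_congr_right fun hij => ?_
  have h1 := h (j + 1) (by omega) le_rfl
  refine and_congr (by omega) (forall_congr' fun m => forall_congr' fun h2 => forall_congr' fun h3 => ?_)
  have := h m (by omega) (by omega)
  omega

lemma Mat_transfer {c c' : ℤ → ℤ} {i j d : ℤ} (h : ∀ k, i ≤ k → k ≤ j → c' (k + d) = c k) :
    Mat c i j ↔ Mat c' (i + d) (j + d) := by
  rw [Mat_iff_pot (c := c) (H := fun n => ht c' (n + d)) (i := i) (j := j)]
  · unfold Mat
    refine and_congr (by omega) (and_congr (by rw [show j + 1 + d = j + d + 1 by ring]) ?_)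
    constructor
    · intro h m h1 h2
      have := h (m - d) (by omega) (by omega)
      simpa using this
    · intro h m h1 h2
      exact h (m + d) (by omega) (by omega)
  · intro n h1 h2
    rw [show n + 1 + d = n + d + 1 by ring, ht_succ, h n h1 h2]

lemma Mat_congr {c c' : ℤ → ℤ} {i j : ℤ} (h : ∀ k, i ≤ k → k ≤ j → c' k = c k) :
    Mat c i j ↔ Mat c' i j := by
  have := Mat_transfer (c := c) (c' := c') (i := i) (j := j) (d := 0) (by simpa using h)
  simpa using this

lemma Mat_rev (c : ℤ → ℤ) (i j : ℤ) : Mat (fun k => -c (-k)) (-j) (-i) ↔ Mat c i j := by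
  rw [Mat_iff_pot (H := fun n => ht c (1 - n))]
  · unfold Mat
    refine and_congr (by omega) ?_
    rw [show 1 - (-i + 1) = i by ring, show 1 - -j = j + 1 by ring, eq_comm]
    refine and_congr_right fun hh => ?_
    · constructor
      · intro h m h1 h2
        have := h (1 - m) (by omega) (by omega)
        rw [show 1 - (1 - m) = m by ring] at this
        have e : ht c (j + 1) = ht c i := hh
        omega
      · intro h m h1 h2
        have := h (1 - m) (by omega) (by omega)
        have e : ht c (j + 1) = ht c i := hh
        omega
  · intro n _ _
    have := ht_succ c (-n)
    rw [show 1 - (n + 1) = -n by ring, show 1 - n = -n + 1 by ring, this]; ring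

lemma Mat_pos {c : ℤ → ℤ} {i j : ℤ} (h : Mat c i j) : 0 < c i ∧ c j < 0 := by
  obtain ⟨h1, h2, h3⟩ := h
  have a := h3 (i + 1) (by omega) (by omega)
  have b := h3 j h1 le_rfl
  rw [ht_succ] at a h2
  omega

lemma Mat_right_unique {c : ℤ → ℤ} {i j j' : ℤ} (h : Mat c i j) (h' : Mat c i j') : j = j' := by
  obtain ⟨h1, h2, h3⟩ := h
  obtain ⟨h1', h2', h3'⟩ := h'
  rcases lt_trichotomy j j' with hl | hl | hl
  · have := h3' (j + 1) (by omega) (by omega); omega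
  · exact hl
  · have := h3 (j' + 1) (by omega) (by omega); omega

lemma Mat_left_unique {c : ℤ → ℤ} {i i' j : ℤ} (h : Mat c i j) (h' : Mat c i' j) : i = i' := by
  obtain ⟨h1, h2, h3⟩ := h
  obtain ⟨h1', h2', h3'⟩ := h'
  rcases lt_trichotomy i i' with hl | hl | hl
  · have := h3 i' (by omega) (by omega); omega
  · exact hl
  · have := h3' i (by omega) (by omega); omega

/-! ### characterization of SigmaD -/
section CharS
variable {M N : ℕ}

def DMSym.val : DMSym M N → ℤ
  | .la _ => 1
  | .u _ => 0
  | .ra _ => -1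

def stn (x : ℤ → DMSym M N) (j : ℤ) (n : ℕ) : DyckElem M :=
  red ((List.range n).map fun m => x (j + m))

lemma dyckStep_ra_concat (bs l : List (Fin M)) (r q : Fin M) :
    dyckStep (N := N) (some (bs, l ++ [r])) (.ra q) = if r = q then some (bs, l) else none := by
  simp [dyckStep]

lemma stn_zero (x : ℤ → DMSym M N) (j : ℤ) : stn x j 0 = some ([], []) := rfl

lemma stn_succ (x : ℤ → DMSym M N) (j : ℤ) (n : ℕ) :
    stn x j (n + 1) = dyckStep (stn x j n) (x (j + n)) := by
  simp [stn, red, List.range_succ, List.foldl_append]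

lemma red_wordAt (x : ℤ → DMSym M N) (j k : ℤ) : red (wordAt x j k) = stn x j (k + 1 - j).toNat := rfl

abbrev cv (x : ℤ → DMSym M N) : ℤ → ℤ := fun i => (x i).val

def GoodSt (x : ℤ → DMSym M N) (t : ℤ) : List (Fin M) → ℤ → Prop
  | [], _ => True
  | k :: ks, h => (∃ i, i < t ∧ x i = .la k ∧ ht (cv x) i = h - 1 ∧
      (∀ m, i < m → m ≤ t → ht (cv x) i < ht (cv x) m)) ∧ GoodSt x t ks (h - 1)

lemma GoodSt_mono {x : ℤ → DMSym M N} {t : ℤ} {ks : List (Fin M)} {h : ℤ} (hg : GoodSt x t ks h)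
    (hh : h ≤ ht (cv x) (t + 1)) : GoodSt x (t + 1) ks h := by
  induction ks generalizing h with
  | nil => trivial
  | cons k ks ih =>
    obtain ⟨⟨i, h1, h2, h3, h4⟩, h5⟩ := hg
    refine ⟨⟨i, by omega, h2, h3, fun m hm hm' => ?_⟩, ih h5 (by omega)⟩
    rcases eq_or_lt_of_le hm' with rfl | hlt
    · omega
    · exact h4 m hm (by omega)

def Cons (x : ℤ → DMSym M N) : Prop :=
  ∀ i j k l, Mat (cv x) i j → x i = .la k → x j = .ra l → k = l

lemma stn_good {x : ℤ → DMSym M N} (hx : Cons x) (j : ℤ) (n : ℕ) :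
    ∃ bs as, stn x j n = some (bs, as) ∧ GoodSt x (j + n) as.reverse (ht (cv x) (j + n)) := by
  induction n with
  | zero => exact ⟨[], [], rfl, trivial⟩
  | succ n ih =>
    obtain ⟨bs, as, h1, h2⟩ := ih
    rw [stn_succ, h1]
    push_cast
    rw [← add_assoc]
    have hs := ht_succ (cv x) (j + n)
    rcases hxn : x (j + n) with k | k | k
    · have hc : cv x (j + n) = 1 := by simp [cv, hxn, DMSym.val]
      refine ⟨bs, as ++ [k], rfl, ?_⟩
      rw [List.reverse_append]
      refine ⟨⟨j + n, by omega, hxn, by omega, fun m h3 h4 => ?_⟩, ?_⟩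
      · obtain rfl : m = j + n + 1 := by omega
        omega
      · change GoodSt x (j + n + 1) as.reverse _
        rw [show ht (cv x) (j + n + 1) - 1 = ht (cv x) (j + n) by omega]
        exact GoodSt_mono h2 (by omega)
    · have hc : cv x (j + n) = 0 := by simp [cv, hxn, DMSym.val]
      refine ⟨bs, as, rfl, ?_⟩
      rw [hs, hc, add_zero]
      exact GoodSt_mono h2 (by omega)
    · have hc : cv x (j + n) = -1 := by simp [cv, hxn, DMSym.val]
      rcases List.eq_nil_or_concat as with rfl | ⟨as0, q, rfl⟩
      · exact ⟨bs ++ [k], [], rfl, trivial⟩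
      · simp only [List.concat_eq_append, List.reverse_append] at h2
        obtain ⟨⟨i, h3, h4, h5, h6⟩, h7⟩ := h2
        have hq : q = k := hx i (j + n) q k ⟨h3, by omega, h6⟩ h4 hxn
        refine ⟨bs, as0, ?_, ?_⟩
        · simp [dyckStep, hq]
        · rw [hs, hc]
          exact GoodSt_mono h7 (by omega)

lemma mem_of_cons {x : ℤ → DMSym M N} (hx : Cons x) : x ∈ SigmaD M N := by
  intro j k _
  rw [red_wordAt]
  obtain ⟨bs, as, h, -⟩ := stn_good hx j (k + 1 - j).toNat
  simp [h]

lemma cons_of_mem {x : ℤ → DMSym M N} (hx : x ∈ SigmaD M N) : Cons x := by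
  intro i j k l hm hk hl
  by_contra hne
  obtain ⟨h1, h2, h3⟩ := hm
  have hcl : cv x j = -1 := by simp [cv, hl, DMSym.val]
  have hcj := ht_succ (cv x) j
  have key : ∀ n : ℕ, i + n + 1 ≤ j → stn x i (n + 1) = none ∨
      ∃ bs as, stn x i (n + 1) = some (bs, k :: as) ∧
        ht (cv x) (i + n + 1) = ht (cv x) i + 1 + as.length := by
    intro n
    induction n with
    | zero =>
      intro _
      right
      refine ⟨[], [], ?_, ?_⟩
      · rw [stn_succ, stn_zero]; simp [hk, dyckStep]
      · have : cv x i = 1 := by simp [cv, hk, DMSym.val]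
        simp [ht_succ]; exact this
    | succ n ih =>
      intro hn
      push_cast at hn ⊢
      rw [stn_succ]
      rcases ih (by omega) with h | ⟨bs, as, h4, h5⟩
      · left; rw [h]; rfl
      have e : i + ((n + 1 : ℕ) : ℤ) = i + n + 1 := by push_cast; ring
      rw [h4, e, ← add_assoc]
      have hs := ht_succ (cv x) (i + n + 1)
      rcases hxn : x (i + n + 1) with q | q | q
      · have hc : cv x (i + n + 1) = 1 := by simp [cv, hxn, DMSym.val]
        right
        exact ⟨bs, as ++ [q], rfl, by rw [hs, hc, h5]; simp; ring⟩
      · have hc : cv x (i + n + 1) = 0 := by simp [cv, hxn, DMSym.val]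
        right
        exact ⟨bs, as, rfl, by rw [hs, hc, h5]; ring⟩
      · have hc : cv x (i + n + 1) = -1 := by simp [cv, hxn, DMSym.val]
        rcases List.eq_nil_or_concat as with rfl | ⟨as0, r, rfl⟩
        · exfalso
          have := h3 (i + n + 1 + 1) (by omega) (by omega)
          simp at h5
          omega
        · by_cases hrq : r = q
          · right
            refine ⟨bs, as0, ?_, ?_⟩
            · rw [List.concat_eq_append, ← List.cons_append]
              rw [dyckStep_ra_concat, if_pos hrq]
            · rw [hs, hc, h5]; simp; ring
          · left
            rw [List.concat_eq_append, ← List.cons_append]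
            rw [dyckStep_ra_concat, if_neg hrq]
  have hkey := key (j - i - 1).toNat (by omega)
  have hnn := hx i j h1
  rw [red_wordAt, show (j + 1 - i).toNat = (j - i - 1).toNat + 1 + 1 by omega, stn_succ,
    show i + (((j - i - 1).toNat + 1 : ℕ) : ℤ) = j by omega] at hnn
  rcases hkey with h | ⟨bs, as, h4, h5⟩
  · rw [h] at hnn; exact hnn rfl
  · rw [show i + ((j - i - 1).toNat : ℤ) + 1 = j by omega] at h5
    have : as.length = 0 := by omega
    obtain rfl := List.length_eq_zero_iff.1 this
    rw [h4, hl] at hnn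
    simp [dyckStep, hne] at hnn

lemma mem_SigmaD_iff {x : ℤ → DMSym M N} : x ∈ SigmaD M N ↔ Cons x :=
  ⟨cons_of_mem, mem_of_cons⟩

lemma stn_lc (j : ℤ) (n : ℕ) : IsLocallyConstant (fun x : ℤ → DMSym M N => stn x j n) := by
  induction n with
  | zero => exact IsLocallyConstant.const _
  | succ n ih =>
    simp only [stn_succ]
    have h : IsLocallyConstant (fun x : ℤ → DMSym M N => x (j + n)) :=
      (IsLocallyConstant.iff_continuous _).2 (continuous_apply _)
    exact (ih.prodMk h).comp (fun q => dyckStep q.1 q.2)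

lemma isClosed_SigmaD : IsClosed (SigmaD M N) := by
  have : SigmaD M N = ⋂ j : ℤ, ⋂ k : ℤ, ⋂ _ : j < k,
      (fun x : ℤ → DMSym M N => stn x j (k + 1 - j).toNat) ⁻¹' {none}ᶜ := by
    ext x
    simp [SigmaD, red_wordAt]
  rw [this]
  refine isClosed_iInter fun j => isClosed_iInter fun k => isClosed_iInter fun _ => ?_
  rw [Set.preimage_compl]
  exact (IsOpen.isClosed_compl (stn_lc j _ _))
end CharS

/-! ### Part 7 -/

open MeasureTheory Topology Filter ProbabilityTheory
open scoped ENNReal NNReal symmDiff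

lemma meas_of_local {A : Type*} [MeasurableSpace A] [Finite A] [DiscreteMeasurableSpace A]
    (s : Finset ℤ) (E : Set (ℤ → A))
    (h : ∀ y y' : ℤ → A, (∀ i ∈ s, y i = y' i) → y ∈ E → y' ∈ E) : MeasurableSet E := by
  have : E = (s.restrict : (ℤ → A) → (s → A)) ⁻¹' ((s.restrict : (ℤ → A) → (s → A)) '' E) := by
    ext y
    constructor
    · exact fun hy => ⟨y, hy, rfl⟩
    · rintro ⟨y', hy', e⟩
      exact h y' y (fun i hi => congrFun e ⟨i, hi⟩) hy'
  rw [this]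
  exact (Finset.measurable_restrict s) (MeasurableSet.of_discrete)

def Col (M N : ℕ) : Type := Option (Fin M ⊕ Fin N)

section Lift
variable {M N : ℕ}

instance : Fintype (Col M N) := inferInstanceAs (Fintype (Option (Fin M ⊕ Fin N)))
instance : DecidableEq (Col M N) := inferInstanceAs (DecidableEq (Option (Fin M ⊕ Fin N)))
instance : MeasurableSpace (Col M N) := ⊤
instance : DiscreteMeasurableSpace (Col M N) := ⟨fun _ => trivial⟩

lemma card_Col : Fintype.card (Col M N) = M + N + 1 := by
  have : Fintype.card (Option (Fin M ⊕ Fin N)) = M + N + 1 := by simp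
  exact this

def Col.la (k : Fin M) : Col M N := some (Sum.inl k)
def Col.u (k : Fin N) : Col M N := some (Sum.inr k)
def Col.be : Col M N := none

lemma Col.cases (c : Col M N) : (∃ k, c = Col.la k) ∨ (∃ k, c = Col.u k) ∨ c = Col.be := by
  rcases c with _ | k | k
  · exact Or.inr (Or.inr rfl)
  · exact Or.inl ⟨k, rfl⟩
  · exact Or.inr (Or.inl ⟨k, rfl⟩)

def col : DMSym M N → Col M N
  | .la k => Col.la k
  | .u k => Col.u k
  | .ra _ => Col.be

def Col.val : Col M N → ℤ
  | some (Sum.inl _) => 1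
  | some (Sum.inr _) => 0
  | none => -1

lemma val_col (s : DMSym M N) : (col s).val = s.val := by cases s <;> rfl

abbrev cw (y : ℤ → Col M N) : ℤ → ℤ := fun i => (y i).val

lemma Col.la_inj {k l : Fin M} (h : (Col.la k : Col M N) = Col.la l) : k = l := by
  exact Sum.inl_injective (Option.some_injective _ h)

lemma Col.val_pos {c : Col M N} (h : 0 < c.val) : ∃ k, c = Col.la k := by
  rcases c.cases with ⟨k, rfl⟩ | ⟨k, rfl⟩ | rfl
  · exact ⟨k, rfl⟩
  · simp [Col.val, Col.u] at h
  · simp [Col.val, Col.be] at h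

lemma DMSym.val_pos {c : DMSym M N} (h : 0 < c.val) : ∃ k, c = DMSym.la k := by
  cases c <;> simp_all [DMSym.val]

def Lab (y : ℤ → Col M N) (j : ℤ) (k : Fin M) : Prop := ∃ i, Mat (cw y) i j ∧ y i = Col.la k

lemma Lab_unique {y : ℤ → Col M N} {j : ℤ} {k l : Fin M} (h : Lab y j k) (h' : Lab y j l) : k = l := by
  obtain ⟨i, h1, h2⟩ := h
  obtain ⟨i', h1', h2'⟩ := h'
  obtain rfl := Mat_left_unique h1 h1'
  exact Col.la_inj (h2.symm.trans h2')

variable [NeZero M]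
open Classical in
noncomputable def lab (y : ℤ → Col M N) (j : ℤ) : Fin M :=
  if h : ∃ k, Lab y j k then h.choose else 0

lemma lab_eq {y : ℤ → Col M N} {j : ℤ} {k : Fin M} (h : Lab y j k) : lab y j = k := by
  have hex : ∃ k, Lab y j k := ⟨k, h⟩
  rw [lab, dif_pos hex]
  exact Lab_unique hex.choose_spec h

noncomputable def liftF (y : ℤ → Col M N) (j : ℤ) : DMSym M N :=
  match y j with
  | some (Sum.inl k) => .la k
  | some (Sum.inr k) => .u k
  | none => .ra (lab y j)

lemma liftF_la {y : ℤ → Col M N} {j : ℤ} {k : Fin M} (h : y j = Col.la k) : liftF y j = .la k := by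
  unfold liftF; rw [h]; rfl
lemma liftF_u {y : ℤ → Col M N} {j : ℤ} {k : Fin N} (h : y j = Col.u k) : liftF y j = .u k := by
  unfold liftF; rw [h]; rfl
lemma liftF_be {y : ℤ → Col M N} {j : ℤ} (h : y j = Col.be) : liftF y j = .ra (lab y j) := by
  unfold liftF; rw [h]; rfl

lemma col_liftF (y : ℤ → Col M N) (j : ℤ) : col (liftF y j) = y j := by
  rcases (y j).cases with ⟨k, h⟩ | ⟨k, h⟩ | h
  · rw [liftF_la h, h]; rfl
  · rw [liftF_u h, h]; rfl
  · rw [liftF_be h, h]; rfl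

lemma cv_liftF (y : ℤ → Col M N) : cv (liftF y) = cw y := by
  funext j; simp only [cv, cw, ← val_col, col_liftF]

lemma liftF_mem (y : ℤ → Col M N) : liftF y ∈ SigmaD M N := by
  refine mem_of_cons fun i j k l hm hi hj => ?_
  rw [cv_liftF] at hm
  have h1 : y i = Col.la k := by rw [← col_liftF y i, hi]; rfl
  have h2 : y j = Col.be := by rw [← col_liftF y j, hj]; rfl
  rw [liftF_be h2] at hj
  have h3 : lab y j = k := lab_eq ⟨i, hm, h1⟩
  rw [h3] at hj
  exact DMSym.ra.inj hj

lemma Lab_shift (y : ℤ → Col M N) (j : ℤ) (k : Fin M) : Lab (shift y) j k ↔ Lab y (j + 1) k := by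
  constructor
  · rintro ⟨i, h1, h2⟩
    exact ⟨i + 1, (Mat_transfer (c := cw (shift y)) (fun n _ _ => rfl)).1 h1, h2⟩
  · rintro ⟨i, h1, h2⟩
    refine ⟨i - 1, ?_, by simpa [shift] using h2⟩
    refine (Mat_transfer (c := cw (shift y)) (c' := cw y) (d := 1) (fun n _ _ => rfl)).2 ?_
    simpa using h1

lemma lab_shift (y : ℤ → Col M N) (j : ℤ) : lab (shift y) j = lab y (j + 1) := by
  by_cases h : ∃ k, Lab y (j + 1) k
  · obtain ⟨k, h⟩ := h
    rw [lab_eq h, lab_eq ((Lab_shift y j k).2 h)]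
  · have h' : ¬ ∃ k, Lab (shift y) j k := fun ⟨k, hk⟩ => h ⟨k, (Lab_shift y j k).1 hk⟩
    simp [lab, h, h']

lemma liftF_shift (y : ℤ → Col M N) : liftF (shift y) = shift (liftF y) := by
  funext j
  change _ = liftF y (j + 1)
  rcases (y (j + 1)).cases with ⟨k, h⟩ | ⟨k, h⟩ | h
  · rw [liftF_la h, liftF_la (y := shift y) h]
  · rw [liftF_u h, liftF_u (y := shift y) h]
  · rw [liftF_be h, liftF_be (y := shift y) h, lab_shift]

lemma Mat_meas (i j : ℤ) : MeasurableSet {y : ℤ → Col M N | Mat (cw y) i j} :=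
  meas_of_local (Finset.Icc i j) _ fun y y' h hy =>
    (Mat_congr (c := cw y) (c' := cw y') fun k h1 h2 => by
      simp only [cw, h k (Finset.mem_Icc.2 ⟨h1, h2⟩)]).1 hy

lemma coord_meas {A : Type*} [MeasurableSpace A] [DiscreteMeasurableSpace A] (i : ℤ) (c : A) :
    MeasurableSet {y : ℤ → A | y i = c} :=
  (measurable_pi_apply (X := fun _ : ℤ => A) i) (MeasurableSet.of_discrete (s := ({c} : Set A)))

lemma Lab_meas (j : ℤ) (k : Fin M) : MeasurableSet {y : ℤ → Col M N | Lab y j k} := by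
  have : {y : ℤ → Col M N | Lab y j k} = ⋃ i : ℤ, {y | Mat (cw y) i j} ∩ {y | y i = Col.la k} := by
    ext y; simp [Lab]
  rw [this]
  exact MeasurableSet.iUnion fun i => (Mat_meas i j).inter (coord_meas i _)

lemma lab_meas (j : ℤ) : Measurable (fun y : ℤ → Col M N => lab y j) := by
  refine measurable_to_countable' fun l => ?_
  have : (fun y : ℤ → Col M N => lab y j) ⁻¹' {l} =
      {y | Lab y j l} ∪ ({y | l = 0} ∩ (⋃ k, {y | Lab y j k})ᶜ) := by
    ext y
    simp only [Set.mem_preimage, Set.mem_singleton_iff, Set.mem_union, Set.mem_setOf_eq,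
      Set.mem_inter_iff, Set.mem_compl_iff, Set.mem_iUnion]
    by_cases h : ∃ k, Lab y j k
    · obtain ⟨k, h⟩ := h
      rw [lab_eq h]
      constructor
      · rintro rfl; exact Or.inl h
      · rintro (h' | ⟨_, h'⟩)
        · exact Lab_unique h h'
        · exact absurd ⟨k, h⟩ h'
    · have : lab y j = 0 := by simp [lab, h]
      rw [this]
      constructor
      · intro h'; exact Or.inr ⟨h'.symm, h⟩
      · rintro (h' | h')
        · exact absurd ⟨l, h'⟩ h
        · exact h'.1.symm
  rw [this]
  exact (Lab_meas j l).union ((MeasurableSet.const _).inter (MeasurableSet.iUnion fun k => Lab_meas j k).compl)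

lemma liftF_meas : Measurable (liftF : (ℤ → Col M N) → ℤ → DMSym M N) := by
  refine measurable_pi_lambda _ fun j => ?_
  have h : Measurable (fun y : ℤ → Col M N => (y j, lab y j)) :=
    (measurable_pi_apply j).prodMk (lab_meas j)
  have : (fun y : ℤ → Col M N => liftF y j) = (fun q : Col M N × Fin M =>
      match q.1 with
      | some (Sum.inl k) => DMSym.la k
      | some (Sum.inr k) => .u k
      | none => .ra q.2) ∘ (fun y : ℤ → Col M N => (y j, lab y j)) := rfl
  rw [this]
  exact (measurable_of_finite _).comp h

noncomputable def lift (y : ℤ → Col M N) : ↥(SigmaD M N) := ⟨liftF y, liftF_mem y⟩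

lemma lift_meas : Measurable (lift : (ℤ → Col M N) → ↥(SigmaD M N)) :=
  liftF_meas.subtype_mk

lemma lift_shift (y : ℤ → Col M N) : lift (shift y) = shiftD M N (lift y) :=
  Subtype.ext (liftF_shift y)

lemma liftF_eq {y : ℤ → Col M N} {j : ℤ} {s : DMSym M N} (h : y j = col s)
    (h' : ∀ l, s = .ra l → Lab y j l) : liftF y j = s := by
  rcases s with k | k | k
  · exact liftF_la h
  · exact liftF_u h
  · rw [liftF_be h, lab_eq (h' k rfl)]

/-- window lemma with translation -/
lemma liftF_window {x : ℤ → DMSym M N} (hx : x ∈ SigmaD M N) {y : ℤ → Col M N} {p j d : ℤ}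
    (hpj : p ≤ j) (hy : ∀ n, p ≤ n → n ≤ j → y (n + d) = col (x n))
    (hm : ∀ l, x j = .ra l → ∃ i, p ≤ i ∧ Mat (cv x) i j) : liftF y (j + d) = x j := by
  refine liftF_eq (hy j hpj le_rfl) fun l hl => ?_
  obtain ⟨i, hi, hij⟩ := hm l hl
  obtain ⟨k, hk⟩ := DMSym.val_pos (Mat_pos hij).1
  have hkl : k = l := cons_of_mem hx i j k l hij hk hl
  refine ⟨i + d, ?_, ?_⟩
  · refine (Mat_transfer (c := cv x) fun n h1 h2 => ?_).1 hij
    simp only [cw, hy n (by omega) h2, val_col]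
  · rw [hy i hi hij.1.le, hk, hkl]; rfl

lemma exists_left_match {c : ℤ → ℤ} (hc : ∀ n, c n ≤ 1) {j b : ℤ} (hj : c j = -1)
    (hb : ∀ n, n < b → c n = 1) : ∃ i, Mat c i j := by
  have hfar : ∀ K : ℕ, ht c (b - K) = ht c b - K := by
    intro K
    induction K with
    | zero => simp
    | succ K ih =>
      have := ht_succ c (b - (K + 1 : ℕ))
      rw [hb _ (by push_cast; omega), show b - ((K + 1 : ℕ) : ℤ) + 1 = b - K by push_cast; ring, ih] at this
      push_cast at this ⊢
      omega
  have hex : ∃ i, i ≤ j ∧ ht c i ≤ ht c (j + 1) := by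
    let K : ℕ := (b - j).toNat + (ht c b - ht c (j + 1)).toNat
    refine ⟨b - K, ?_, ?_⟩
    · simp only [K]; push_cast; omega
    · rw [hfar]; simp only [K]; push_cast; omega
  obtain ⟨i, ⟨h1, h2⟩, h3⟩ := Int.exists_greatest_of_bdd (P := fun i => i ≤ j ∧ ht c i ≤ ht c (j + 1))
    ⟨j, fun z hz => hz.1⟩ hex
  have hsj := ht_succ c j
  have hij : i < j := by
    rcases eq_or_lt_of_le h1 with rfl | h
    · omega
    · exact h
  have hgt : ∀ m, i < m → m ≤ j → ht c (j + 1) < ht c m := by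
    intro m hm hmj
    by_contra hcon
    have := h3 m ⟨hmj, by omega⟩
    omega
  have := hgt (i + 1) (by omega) (by omega)
  have h5 := ht_succ c i
  have h6 := hc i
  have heq : ht c (j + 1) = ht c i := by omega
  exact ⟨i, hij, heq, fun m a b => by have := hgt m a b; omega⟩

lemma Col.val_le (c : Col M N) : c.val ≤ 1 := by
  rcases c.cases with ⟨k, rfl⟩ | ⟨k, rfl⟩ | rfl <;> simp [Col.val, Col.la, Col.u, Col.be]

lemma full_window {x : ℤ → DMSym M N} (hx : x ∈ SigmaD M N) (n : ℕ) :
    ∃ (p : ℤ) (y0 : ℤ → Col M N), p ≤ -n ∧ ∀ y : ℤ → Col M N, (∀ i, p ≤ i → i ≤ n → y i = y0 i) →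
      ∀ j, -(n : ℤ) ≤ j → j ≤ n → liftF y j = x j := by
  classical
  let c0 : ℤ → ℤ := fun i => if i < -(n : ℤ) then 1 else cv x i
  let P : ℤ → Fin M → Prop := fun i l => ∃ j, -(n : ℤ) ≤ j ∧ j ≤ n ∧ Mat c0 i j ∧ x j = .ra l
  have hP : ∀ i l l', P i l → P i l' → l = l' := by
    rintro i l l' ⟨j, _, _, h1, h2⟩ ⟨j', _, _, h1', h2'⟩
    obtain rfl := Mat_right_unique h1 h1'
    exact DMSym.ra.inj (h2.symm.trans h2')
  let lbl : ℤ → Fin M := fun i => if h : ∃ l, P i l then h.choose else 0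
  have hlbl : ∀ i l, P i l → lbl i = l := by
    intro i l h
    have hex : ∃ l, P i l := ⟨l, h⟩
    simp only [lbl, dif_pos hex]
    exact hP i _ _ hex.choose_spec h
  let y0 : ℤ → Col M N := fun i => if i < -(n : ℤ) then Col.la (lbl i) else col (x i)
  have hy0 : cw y0 = c0 := by
    funext i
    by_cases h : i < -(n : ℤ)
    · simp [cw, y0, c0, h, Col.val, Col.la]
    · simp [cw, y0, c0, h, val_col]
  have key : ∀ j, -(n : ℤ) ≤ j → j ≤ n → ∀ l, x j = .ra l → ∃ i, Mat c0 i j ∧ y0 i = Col.la l := by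
    intro j h1 h2 l hl
    have hcj : c0 j = -1 := by
      simp only [c0, if_neg (show ¬ j < -(n : ℤ) by omega), cv, hl, DMSym.val]
    obtain ⟨i, hi⟩ := exists_left_match (c := c0) (b := -(n : ℤ)) (fun m => by
      rw [← hy0]; exact Col.val_le _) hcj (fun m hm => by simp [c0, hm])
    refine ⟨i, hi, ?_⟩
    by_cases hin : i < -(n : ℤ)
    · simp only [y0, if_pos hin]
      rw [hlbl i l ⟨j, h1, h2, hi, hl⟩]
    · have hi' : Mat (cv x) i j := by
        refine (Mat_congr fun k h3 h4 => ?_).1 hi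
        simp only [c0, if_neg (show ¬ k < -(n : ℤ) by omega)]
      obtain ⟨k, hk⟩ := DMSym.val_pos (Mat_pos hi').1
      have hkl : k = l := cons_of_mem hx i j k l hi' hk hl
      simp only [y0, if_neg hin, hk, hkl]; rfl
  obtain ⟨p, hp1, hp⟩ : ∃ p : ℤ, p ≤ -n ∧ ∀ j, -(n : ℤ) ≤ j → j ≤ n → ∀ l, x j = .ra l →
      ∃ i, p ≤ i ∧ Mat c0 i j ∧ y0 i = Col.la l := by
    have : ∀ j : ℤ, ∃ i : ℤ, -(n : ℤ) ≤ j → j ≤ n → ∀ l, x j = .ra l → Mat c0 i j ∧ y0 i = Col.la l := by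
      intro j
      by_cases h : -(n : ℤ) ≤ j ∧ j ≤ n ∧ ∃ l, x j = .ra l
      · obtain ⟨h1, h2, l, hl⟩ := h
        obtain ⟨i, hi⟩ := key j h1 h2 l hl
        refine ⟨i, fun _ _ l' hl' => ?_⟩
        obtain rfl := DMSym.ra.inj (hl.symm.trans hl')
        exact hi
      · exact ⟨0, fun h1 h2 l hl => absurd ⟨h1, h2, l, hl⟩ h⟩
    choose I hI using this
    obtain ⟨p, hp⟩ := (insert (-(n : ℤ)) ((Finset.Icc (-(n : ℤ)) n).image I)).bddBelow
    refine ⟨p, hp (Finset.mem_coe.2 (Finset.mem_insert_self _ _)), fun j h1 h2 l hl => ⟨I j, hp (Finset.mem_coe.2 ?_), hI j h1 h2 l hl⟩⟩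
    exact Finset.mem_insert_of_mem (Finset.mem_image_of_mem _ (Finset.mem_Icc.2 ⟨h1, h2⟩))
  refine ⟨p, y0, hp1, fun y hy j h1 h2 => ?_⟩
  refine liftF_eq ?_ fun l hl => ?_
  · rw [hy j (by omega) h2]
    simp only [y0, if_neg (show ¬ j < -(n : ℤ) by omega)]
  · obtain ⟨i, h3, h4, h5⟩ := hp j h1 h2 l hl
    refine ⟨i, ?_, ?_⟩
    · refine (Mat_congr fun k h6 h7 => ?_).1 h4
      rw [← hy0]; simp only [cw, hy k (by omega) (by omega)]
    · rw [hy i h3 (by have := h4.1; omega), h5]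

end Lift

/-! ### Part 8 -/

open MeasureTheory Topology Filter ProbabilityTheory
open scoped ENNReal NNReal symmDiff

section Swap
variable {A : Type*} (a : A) (W : ℤ → A) (n : ℕ)

/-- good marker -/
def GM (x : ℤ → A) (i : ℤ) : Prop := x i ≠ a ∧ ∀ k, i < k → k ≤ i + n → x k = a

def Blk (x : ℤ → A) (i j : ℤ) : Prop :=
  GM a n x i ∧ GM a n x j ∧ i < j ∧ ∀ m, i < m → m < j → ¬ GM a n x m

def isA (x : ℤ → A) (i j : ℤ) : Prop := ∀ k, i + n < k → k < j → x k = a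
def isW (x : ℤ → A) (i j : ℤ) : Prop := ∀ k, i + n < k → k < j → x k = W (k - i - n - 1)

def Sw (x : ℤ → A) (k : ℤ) (b : A) : Prop :=
  ∃ i j, Blk a n x i j ∧ i + n < k ∧ k < j ∧
    ((isA a n x i j ∧ b = W (k - i - n - 1)) ∨ (isW W n x i j ∧ b = a))

open Classical in
noncomputable def Phi (x : ℤ → A) (k : ℤ) : A :=
  if h : ∃ b, Sw a W n x k b then h.choose else x k

variable {a W n}

lemma Blk_unique {x : ℤ → A} {i j i' j' k : ℤ} (h : Blk a n x i j) (h' : Blk a n x i' j')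
    (h1 : i ≤ k) (h2 : k < j) (h1' : i' ≤ k) (h2' : k < j') : i = i' ∧ j = j' := by
  obtain ⟨g1, g2, _, g4⟩ := h
  obtain ⟨g1', g2', _, g4'⟩ := h'
  have e1 : i = i' := by
    rcases lt_trichotomy i i' with hl | hl | hl
    · exact absurd g1' (g4 i' hl (by omega))
    · exact hl
    · exact absurd g1 (g4' i hl (by omega))
  refine ⟨e1, ?_⟩
  rcases lt_trichotomy j j' with hl | hl | hl
  · exact absurd g2 (g4' j (by omega) hl)
  · exact hl
  · exact absurd g2' (g4 j' (by omega) hl)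

lemma not_isA_isW (hW0 : W 0 ≠ a) {x : ℤ → A} {i j k : ℤ} (h1 : i + n < k) (h2 : k < j)
    (hA : isA a n x i j) (hW : isW W n x i j) : False := by
  have e1 := hA (i + n + 1) (by omega) (by omega)
  have e2 := hW (i + n + 1) (by omega) (by omega)
  rw [show i + n + 1 - i - n - 1 = (0 : ℤ) by ring] at e2
  exact hW0 (e2.symm.trans e1)

lemma Sw_unique (hW0 : W 0 ≠ a) {x : ℤ → A} {k : ℤ} {b b' : A} (h : Sw a W n x k b)
    (h' : Sw a W n x k b') : b = b' := by
  obtain ⟨i, j, h1, h2, h3, h4⟩ := h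
  obtain ⟨i', j', h1', h2', h3', h4'⟩ := h'
  obtain ⟨rfl, rfl⟩ := Blk_unique h1 h1' (k := k) (by omega) h3 (by omega) h3'
  rcases h4 with ⟨h4, rfl⟩ | ⟨h4, rfl⟩ <;> rcases h4' with ⟨h4', rfl⟩ | ⟨h4', rfl⟩
  · rfl
  · exact (not_isA_isW hW0 h2 h3 h4 h4').elim
  · exact (not_isA_isW hW0 h2 h3 h4' h4).elim
  · rfl

lemma Phi_eq (hW0 : W 0 ≠ a) {x : ℤ → A} {k : ℤ} {b : A} (h : Sw a W n x k b) :
    Phi a W n x k = b := by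
  have hex : ∃ b, Sw a W n x k b := ⟨b, h⟩
  rw [Phi, dif_pos hex]
  exact Sw_unique hW0 hex.choose_spec h

lemma Phi_eq_self {x : ℤ → A} {k : ℤ} (h : ¬ ∃ b, Sw a W n x k b) : Phi a W n x k = x k := by
  rw [Phi, dif_neg h]

/-- positions next to a good marker are never swapped -/
lemma not_Sw_of_GM {x : ℤ → A} {i k : ℤ} (h : GM a n x i) (h1 : i ≤ k) (h2 : k ≤ i + n) :
    ¬ ∃ b, Sw a W n x k b := by
  rintro ⟨b, i', j', ⟨g1, g2, g3, g4⟩, h3, h4, -⟩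
  exact g4 i (by omega) (by omega) h

lemma Phi_GM {x : ℤ → A} {i k : ℤ} (h : GM a n x i) (h1 : i ≤ k) (h2 : k ≤ i + n) :
    Phi a W n x k = x k := Phi_eq_self (not_Sw_of_GM h h1 h2)

lemma GM_Phi {x : ℤ → A} {i : ℤ} (h : GM a n x i) : GM a n (Phi a W n x) i := by
  refine ⟨?_, fun k h1 h2 => ?_⟩
  · rw [Phi_GM h le_rfl (by omega)]; exact h.1
  · rw [Phi_GM h h1.le h2]; exact h.2 k h1 h2


lemma W_mul (hn : 0 < n) (hW : ∀ m, W (m + n) = W m) (hW0 : W 0 ≠ a)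
    (q : ℕ) : W (n * q) = W 0 := by
  induction q with
  | zero => simp
  | succ q ih => rw [← ih, ← hW (n * q)]; congr 1

lemma GM_of_Phi (hn : 0 < n) (hW : ∀ m, W (m + n) = W m) (hW0 : W 0 ≠ a)
    {x : ℤ → A} {i : ℤ} (h : GM a n (Phi a W n x) i) : GM a n x i := by
  by_cases hs : ∃ b, Sw a W n x i b
  · exfalso
    obtain ⟨b, hb⟩ := hs
    have e := Phi_eq hW0 hb
    obtain ⟨i0, j0, h1, h2, h3, h4⟩ := hb
    rcases h4 with ⟨h4, h5⟩ | ⟨h4, h5⟩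
    · by_cases hj : j0 ≤ i + n
      · have := h.2 j0 h3 hj
        rw [Phi_GM h1.2.1 le_rfl (by omega)] at this
        exact h1.2.1.1 this
      · -- the next multiple of n
        let m : ℤ := i - i0 - n - 1
        have hm : 0 ≤ m := by simp only [m]; omega
        let q : ℕ := (m / n + 1).toNat
        have hdiv := Int.emod_add_mul_ediv m n
        have hr0 := Int.emod_nonneg m (show (n : ℤ) ≠ 0 by omega)
        have hr1 := Int.emod_lt_of_pos m (show (0 : ℤ) < n by omega)
        have hq0 : 0 ≤ m / n := Int.ediv_nonneg hm (by omega)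
        have hq : (n : ℤ) * q = n * (m / n) + n := by
          simp only [q]; rw [Int.toNat_of_nonneg (by omega)]; ring
        have hk1 : m < n * q := by omega
        have hk2 : n * q ≤ m + n := by omega
        let k : ℤ := n * q + i0 + n + 1
        have hki : i < k := by simp only [k, m] at *; omega
        have hki2 : k ≤ i + n := by simp only [k, m] at *; omega
        have hka := h.2 k hki hki2
        have : Phi a W n x k = W 0 := by
          rw [Phi_eq hW0 (b := W (k - i0 - n - 1)) ⟨i0, j0, h1, by omega, by omega, Or.inl ⟨h4, rfl⟩⟩]
          rw [show k - i0 - n - 1 = n * q by simp only [k]; ring]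
          exact W_mul hn hW hW0 q
        exact hW0 (this.symm.trans hka)
    · exact h.1 (e.trans h5)
  · have hxi : x i ≠ a := by rw [← Phi_eq_self hs]; exact h.1
    refine ⟨hxi, fun k h1 h2 => ?_⟩
    by_contra hk
    have hPk := h.2 k h1 h2
    by_cases hsk : ∃ b, Sw a W n x k b
    · obtain ⟨b, i0, j0, g1, g2, g3, g4⟩ := hsk
      -- i is not in the content
      have hi : i ≤ i0 + n := by
        by_contra hcon
        rcases g4 with ⟨g4, _⟩ | ⟨g4, _⟩
        · exact hs ⟨_, i0, j0, g1, by omega, by omega, Or.inl ⟨g4, rfl⟩⟩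
        · exact hs ⟨_, i0, j0, g1, by omega, by omega, Or.inr ⟨g4, rfl⟩⟩
      have hi2 : i0 ≤ i := by omega
      rcases eq_or_lt_of_le hi2 with rfl | hlt
      · exact hk (g1.1.2 k h1 (by omega))
      · exact hxi (g1.1.2 i hlt hi)
    · rw [Phi_eq_self hsk] at hPk
      exact hk hPk

lemma GM_Phi_iff (hn : 0 < n) (hW : ∀ m, W (m + n) = W m) (hW0 : W 0 ≠ a)
    {x : ℤ → A} {i : ℤ} : GM a n (Phi a W n x) i ↔ GM a n x i :=
  ⟨GM_of_Phi hn hW hW0, GM_Phi⟩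

lemma Blk_Phi_iff (hn : 0 < n) (hW : ∀ m, W (m + n) = W m) (hW0 : W 0 ≠ a)
    {x : ℤ → A} {i j : ℤ} : Blk a n (Phi a W n x) i j ↔ Blk a n x i j := by
  simp only [Blk, GM_Phi_iff hn hW hW0]

lemma Phi_Phi (hn : 0 < n) (hW : ∀ m, W (m + n) = W m) (hW0 : W 0 ≠ a)
    (x : ℤ → A) : Phi a W n (Phi a W n x) = x := by
  funext k
  by_cases hs : ∃ b, Sw a W n x k b
  · obtain ⟨b, i, j, h1, h2, h3, h4⟩ := hs
    have h1' := (Blk_Phi_iff hn hW hW0 (x := x)).2 h1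
    rcases h4 with ⟨h4, h5⟩ | ⟨h4, h5⟩
    · have : isW W n (Phi a W n x) i j := fun m hm1 hm2 =>
        Phi_eq hW0 ⟨i, j, h1, hm1, hm2, Or.inl ⟨h4, rfl⟩⟩
      rw [Phi_eq hW0 ⟨i, j, h1', h2, h3, Or.inr ⟨this, rfl⟩⟩, h4 k h2 h3]
    · have : isA a n (Phi a W n x) i j := fun m hm1 hm2 =>
        Phi_eq hW0 ⟨i, j, h1, hm1, hm2, Or.inr ⟨h4, rfl⟩⟩
      rw [Phi_eq hW0 ⟨i, j, h1', h2, h3, Or.inl ⟨this, rfl⟩⟩, h4 k h2 h3]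
  · have hs' : ¬ ∃ b, Sw a W n (Phi a W n x) k b := by
      rintro ⟨b, i, j, h1, h2, h3, h4⟩
      rw [Blk_Phi_iff hn hW hW0] at h1
      have hsame : ∀ m, i + n < m → m < j → Phi a W n x m = x m := by
        intro m hm1 hm2
        refine Phi_eq_self ?_
        rintro ⟨b', i', j', g1, g2, g3, g4⟩
        obtain ⟨rfl, rfl⟩ := Blk_unique h1 g1 (k := m) (by omega) hm2 (by omega) g3
        rcases g4 with ⟨g4, _⟩ | ⟨g4, _⟩
        · exact hs ⟨_, i, j, h1, h2, h3, Or.inl ⟨g4, rfl⟩⟩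
        · exact hs ⟨_, i, j, h1, h2, h3, Or.inr ⟨g4, rfl⟩⟩
      rcases h4 with ⟨h4, _⟩ | ⟨h4, _⟩
      · exact hs ⟨_, i, j, h1, h2, h3, Or.inl ⟨fun m g1 g2 => by
          rw [← hsame m g1 g2]; exact h4 m g1 g2, rfl⟩⟩
      · exact hs ⟨_, i, j, h1, h2, h3, Or.inr ⟨fun m g1 g2 => by
          rw [← hsame m g1 g2]; exact h4 m g1 g2, rfl⟩⟩
    rw [Phi_eq_self hs', Phi_eq_self hs]


lemma GM_congr {x x' : ℤ → A} {i : ℤ} (h : ∀ k, i ≤ k → k ≤ i + n → x k = x' k)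
    (hg : GM a n x i) : GM a n x' i :=
  ⟨by rw [← h i le_rfl (by omega)]; exact hg.1, fun k h1 h2 => by
    rw [← h k h1.le h2]; exact hg.2 k h1 h2⟩

lemma Blk_congr {x x' : ℤ → A} {i j : ℤ} (h : ∀ k, i ≤ k → k ≤ j + n → x k = x' k)
    (hg : Blk a n x i j) : Blk a n x' i j := by
  obtain ⟨h1, h2, h3, h4⟩ := hg
  refine ⟨GM_congr (fun k a b => h k a (by omega)) h1,
    GM_congr (fun k a b => h k (by omega) b) h2, h3, fun m a b hc => h4 m a b ?_⟩
  exact GM_congr (fun k c d => (h k (by omega) (by omega)).symm) hc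

lemma isA_congr {x x' : ℤ → A} {i j : ℤ} (h : ∀ k, i ≤ k → k ≤ j + n → x k = x' k)
    (hg : isA a n x i j) : isA a n x' i j := fun k h1 h2 => by
  rw [← h k (by omega) (by omega)]; exact hg k h1 h2

lemma isW_congr {x x' : ℤ → A} {i j : ℤ} (h : ∀ k, i ≤ k → k ≤ j + n → x k = x' k)
    (hg : isW W n x i j) : isW W n x' i j := fun k h1 h2 => by
  rw [← h k (by omega) (by omega)]; exact hg k h1 h2

lemma Sw_congr {x x' : ℤ → A} {g g' k : ℤ} {b : A} (hg : GM a n x g) (hg' : GM a n x g')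
    (h : ∀ m, g ≤ m → m ≤ g' + n → x m = x' m) (hk : g ≤ k) (hk' : k ≤ g' + n)
    (hs : Sw a W n x k b) : Sw a W n x' k b := by
  obtain ⟨i, j, h1, h2, h3, h4⟩ := hs
  have e1 : g ≤ i := by
    by_contra hc
    exact h1.2.2.2 g (by omega) (by omega) hg
  have e2 : j ≤ g' := by
    by_contra hc
    exact h1.2.2.2 g' (by omega) (by omega) hg'
  have e : ∀ m, i ≤ m → m ≤ j + n → x m = x' m := fun m a b => h m (by omega) (by omega)
  refine ⟨i, j, Blk_congr e h1, h2, h3, ?_⟩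
  exact h4.imp (fun q => ⟨isA_congr e q.1, q.2⟩) (fun q => ⟨isW_congr e q.1, q.2⟩)

lemma Phi_congr (hW0 : W 0 ≠ a) {x x' : ℤ → A} {g g' k : ℤ} (hgg : g ≤ g') (hg : GM a n x g) (hg' : GM a n x g')
    (h : ∀ m, g ≤ m → m ≤ g' + n → x m = x' m) (hk : g ≤ k) (hk' : k ≤ g' + n) :
    Phi a W n x k = Phi a W n x' k := by
  by_cases hs : ∃ b, Sw a W n x k b
  · obtain ⟨b, hb⟩ := hs
    rw [Phi_eq hW0 hb, Phi_eq hW0 (Sw_congr hg hg' h hk hk' hb)]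
  · have hs' : ¬ ∃ b, Sw a W n x' k b := by
      rintro ⟨b, hb⟩
      refine hs ⟨b, Sw_congr (GM_congr (fun k a b => h k a (by omega)) hg)
        (GM_congr (fun k a b => h k (by omega) b) hg') (fun m a b => (h m a b).symm) hk hk' hb⟩
    rw [Phi_eq_self hs, Phi_eq_self hs', h k hk hk']

lemma GM_shift (x : ℤ → A) (i : ℤ) : GM a n (shift x) i ↔ GM a n x (i + 1) := by
  simp only [GM, shift]
  refine and_congr_right fun _ => ⟨fun h k h1 h2 => ?_, fun h k h1 h2 => h (k + 1) (by omega) (by omega)⟩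
  have := h (k - 1) (by omega) (by omega)
  simpa using this

lemma Sw_shift (x : ℤ → A) (k : ℤ) (b : A) : Sw a W n (shift x) k b ↔ Sw a W n x (k + 1) b := by
  have hB : ∀ i j, Blk a n (shift x) i j ↔ Blk a n x (i + 1) (j + 1) := by
    intro i j
    simp only [Blk, GM_shift]
    refine and_congr_right fun _ => and_congr_right fun _ => and_congr (by omega) ?_
    refine ⟨fun h k h1 h2 => ?_, fun h k h1 h2 => h (k + 1) (by omega) (by omega)⟩
    have := h (k - 1) (by omega) (by omega)
    simpa using this
  have hA : ∀ i j, isA a n (shift x) i j ↔ isA a n x (i + 1) (j + 1) := by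
    intro i j
    simp only [isA, shift]
    refine ⟨fun h k h1 h2 => ?_, fun h k h1 h2 => h (k + 1) (by omega) (by omega)⟩
    have := h (k - 1) (by omega) (by omega)
    simpa using this
  have hWW : ∀ i j, isW W n (shift x) i j ↔ isW W n x (i + 1) (j + 1) := by
    intro i j
    simp only [isW, shift]
    refine ⟨fun h k h1 h2 => ?_, fun h k h1 h2 => ?_⟩
    · have := h (k - 1) (by omega) (by omega)
      simp only [sub_add_cancel] at this
      rw [this]; congr 1; ring
    · rw [h (k + 1) (by omega) (by omega)]; congr 1; ring
  constructor
  · rintro ⟨i, j, h1, h2, h3, h4⟩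
    refine ⟨i + 1, j + 1, (hB i j).1 h1, by omega, by omega, ?_⟩
    rw [← hA, ← hWW, show k + 1 - (i + 1) - n - 1 = k - i - n - 1 by ring]
    exact h4
  · rintro ⟨i, j, h1, h2, h3, h4⟩
    refine ⟨i - 1, j - 1, (hB _ _).2 (by simpa using h1), by omega, by omega, ?_⟩
    rw [hA, hWW, show k - (i - 1) - n - 1 = k + 1 - i - n - 1 by ring]
    simpa using h4

lemma Phi_shift (hW0 : W 0 ≠ a) (x : ℤ → A) : Phi a W n (shift x) = shift (Phi a W n x) := by
  funext k
  change _ = Phi a W n x (k + 1)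
  by_cases hs : ∃ b, Sw a W n x (k + 1) b
  · obtain ⟨b, hb⟩ := hs
    rw [Phi_eq hW0 hb, Phi_eq hW0 ((Sw_shift x k b).2 hb)]
  · have hs' : ¬ ∃ b, Sw a W n (shift x) k b := fun ⟨b, hb⟩ => hs ⟨b, (Sw_shift x k b).1 hb⟩
    rw [Phi_eq_self hs, Phi_eq_self hs']; rfl

lemma Sw_meas [MeasurableSpace A] [Finite A] [DiscreteMeasurableSpace A] (k : ℤ) (b : A) :
    MeasurableSet {x : ℤ → A | Sw a W n x k b} := by
  have : {x : ℤ → A | Sw a W n x k b} = ⋃ i : ℤ, ⋃ j : ℤ, {x | Blk a n x i j ∧ i + n < k ∧ k < j ∧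
    ((isA a n x i j ∧ b = W (k - i - n - 1)) ∨ (isW W n x i j ∧ b = a))} := by
    ext x; simp [Sw]
  rw [this]
  refine MeasurableSet.iUnion fun i => MeasurableSet.iUnion fun j => ?_
  refine meas_of_local (Finset.Icc i (j + n)) _ fun y y' h hy => ?_
  have e : ∀ m, i ≤ m → m ≤ j + n → y m = y' m := fun m a b => h m (Finset.mem_Icc.2 ⟨a, b⟩)
  obtain ⟨h1, h2, h3, h4⟩ := hy
  exact ⟨Blk_congr e h1, h2, h3,
    h4.imp (fun q => ⟨isA_congr e q.1, q.2⟩) (fun q => ⟨isW_congr e q.1, q.2⟩)⟩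

lemma Phi_meas (hW0 : W 0 ≠ a) [MeasurableSpace A] [Finite A] [DiscreteMeasurableSpace A] :
    Measurable (Phi a W n) := by
  refine measurable_pi_lambda _ fun k => ?_
  refine measurable_to_countable' fun l => ?_
  have : (fun y : ℤ → A => Phi a W n y k) ⁻¹' {l} =
      {y | Sw a W n y k l} ∪ ({y | y k = l} ∩ (⋃ b, {y | Sw a W n y k b})ᶜ) := by
    ext y
    simp only [Set.mem_preimage, Set.mem_singleton_iff, Set.mem_union, Set.mem_setOf_eq,
      Set.mem_inter_iff, Set.mem_compl_iff, Set.mem_iUnion]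
    by_cases h : ∃ b, Sw a W n y k b
    · obtain ⟨b, h⟩ := h
      rw [Phi_eq hW0 h]
      constructor
      · rintro rfl; exact Or.inl h
      · rintro (h' | ⟨_, h'⟩)
        · exact Sw_unique hW0 h h'
        · exact absurd ⟨b, h⟩ h'
    · rw [Phi_eq_self h]
      constructor
      · intro h'; exact Or.inr ⟨h', h⟩
      · rintro (h' | h')
        · exact absurd ⟨l, h'⟩ h
        · exact h'.1
  rw [this]
  exact (Sw_meas k l).union ((coord_meas k l).inter (MeasurableSet.iUnion fun b => Sw_meas k b).compl)

end Swap

/-! ### Part 9 -/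

open MeasureTheory Topology Filter ProbabilityTheory
open scoped ENNReal NNReal symmDiff

section Top
variable {M N : ℕ}

lemma open_cyl {U : Set ↥(SigmaD M N)} (hU : IsOpen U) {x : ↥(SigmaD M N)} (hx : x ∈ U) :
    ∃ m : ℕ, ∀ y : ↥(SigmaD M N), (∀ i : ℤ, -m ≤ i → i ≤ m → y.1 i = x.1 i) → y ∈ U := by
  obtain ⟨V, hV, rfl⟩ := isOpen_induced_iff.1 hU
  obtain ⟨I, u, hu, hs⟩ := isOpen_pi_iff.1 hV x.1 hx
  refine ⟨∑ i ∈ I, i.natAbs, fun y hy => hs ?_⟩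
  intro i hi
  have : i.natAbs ≤ ∑ i ∈ I, i.natAbs :=
    Finset.single_le_sum (f := fun i : ℤ => i.natAbs) (fun _ _ => Nat.zero_le _) hi
  rw [hy i (by omega) (by omega)]
  exact (hu i hi).2

lemma cyl_open (x : ↥(SigmaD M N)) (m : ℕ) :
    IsOpen {y : ↥(SigmaD M N) | ∀ i : ℤ, -m ≤ i → i ≤ m → y.1 i = x.1 i} := by
  have : {y : ↥(SigmaD M N) | ∀ i : ℤ, -m ≤ i → i ≤ m → y.1 i = x.1 i}
      = ⋂ i ∈ Finset.Icc (-m : ℤ) m, {y | y.1 i = x.1 i} := by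
    ext y; simp
  rw [this]
  refine isOpen_biInter_finset fun i _ => ?_
  have hc : Continuous (fun y : ↥(SigmaD M N) => y.1 i) :=
    (continuous_apply i).comp continuous_subtype_val
  exact (isOpen_discrete {x.1 i}).preimage hc

instance : CompactSpace ↥(SigmaD M N) := isCompact_iff_compactSpace.1 isClosed_SigmaD.isCompact

lemma unif_cyl (f : C(↥(SigmaD M N), ℝ)) {η : ℝ} (hη : 0 < η) :
    ∃ m : ℕ, ∀ x y : ↥(SigmaD M N), (∀ i : ℤ, -m ≤ i → i ≤ m → y.1 i = x.1 i) →
      |f y - f x| < η := by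
  have h1 : ∀ x : ↥(SigmaD M N), ∃ m : ℕ, ∀ y : ↥(SigmaD M N),
      (∀ i : ℤ, -m ≤ i → i ≤ m → y.1 i = x.1 i) → y ∈ f ⁻¹' Metric.ball (f x) (η / 2) := fun x =>
    open_cyl (Metric.isOpen_ball.preimage f.continuous) (by simpa using half_pos hη)
  choose m hm using h1
  obtain ⟨t, ht⟩ := isCompact_univ.elim_finite_subcover
    (fun x => {y : ↥(SigmaD M N) | ∀ i : ℤ, -(m x) ≤ i → i ≤ m x → y.1 i = x.1 i})
    (fun x => cyl_open x (m x)) (fun x _ => Set.mem_iUnion.2 ⟨x, fun i _ _ => rfl⟩)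
  refine ⟨∑ x ∈ t, m x, fun x y hxy => ?_⟩
  obtain ⟨z, hz⟩ := Set.mem_iUnion.1 (ht (Set.mem_univ x))
  obtain ⟨hzt, hz⟩ := Set.mem_iUnion.1 hz
  have hle : m z ≤ ∑ x ∈ t, m x :=
    Finset.single_le_sum (f := fun x => m x) (fun _ _ => Nat.zero_le _) hzt
  have a1 := hm z x hz
  have a2 := hm z y (fun i h h' => by
    rw [hxy i (by omega) (by omega)]; exact hz i h h')
  simp only [Set.mem_preimage, Metric.mem_ball, Real.dist_eq] at a1 a2
  rw [abs_lt] at *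
  constructor <;> linarith

lemma shiftD_cont : Continuous (shiftD M N) := by
  refine Continuous.subtype_mk ?_ _
  refine continuous_pi fun i => ?_
  exact (continuous_apply (i + 1)).comp continuous_subtype_val

lemma sigma_eq_meas {F : ↥(SigmaD M N) → ↥(SigmaD M N)} (hF : Measurable F) :
    MeasurableSet {x | F x = x} := by
  have : {x | F x = x} = ⋂ i : ℤ, {x | (F x).1 i = x.1 i} := by
    ext x; simp [Subtype.ext_iff, funext_iff]
  rw [this]
  refine MeasurableSet.iInter fun i => ?_
  have h1 : Measurable (fun x => (F x).1 i) :=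
    (measurable_pi_apply i).comp (measurable_subtype_coe.comp hF)
  have h2 : Measurable (fun x : ↥(SigmaD M N) => x.1 i) :=
    (measurable_pi_apply i).comp measurable_subtype_coe
  exact (h1.prodMk h2) (MeasurableSet.of_discrete (s := {q : DMSym M N × DMSym M N | q.1 = q.2}))

end Top

section Fam
variable {M N : ℕ} [NeZero M]

noncomputable def Psi (a : Col M N) (W : ℤ → Col M N) (n : ℕ) (x : ℤ → Col M N) : ↥(SigmaD M N) :=
  lift (Phi a W n x)

noncomputable def PsiInv (a : Col M N) (W : ℤ → Col M N) (n : ℕ) (x : ↥(SigmaD M N)) : ℤ → Col M N :=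
  Phi a W n (fun i => col (x.1 i))

variable {a : Col M N} {W : ℤ → Col M N} {n : ℕ} 

lemma Psi_meas (hW0 : W 0 ≠ a) : Measurable (Psi a W n) := lift_meas.comp (Phi_meas hW0)

lemma PsiInv_meas (hW0 : W 0 ≠ a) : Measurable (PsiInv a W n) := by
  refine (Phi_meas hW0).comp (measurable_pi_lambda _ fun i => ?_)
  exact (measurable_of_countable col).comp ((measurable_pi_apply i).comp measurable_subtype_coe)

lemma PsiInv_Psi (hn : 0 < n) (hW : ∀ m, W (m + n) = W m) (hW0 : W 0 ≠ a) (x : ℤ → Col M N) :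
    PsiInv a W n (Psi a W n x) = x := by
  unfold PsiInv Psi
  have : (fun i => col ((lift (Phi a W n x)).1 i)) = Phi a W n x := funext fun i => col_liftF _ i
  rw [this, Phi_Phi hn hW hW0]

lemma Psi_shift (hW0 : W 0 ≠ a) (x : ℤ → Col M N) :
    Psi a W n (shift x) = shiftD M N (Psi a W n x) := by
  unfold Psi
  rw [Phi_shift hW0, lift_shift]

lemma pw_pos {A : Type*} [MeasurableSpace A] [Fintype A] [DecidableEq A]
    [MeasurableSingletonClass A] (a : A) {δ : ℝ} (h0 : 0 < δ) (h1 : δ < 1)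
    (hc : 2 ≤ Fintype.card A) (b : A) : 0 < pw a δ {b} := by
  rw [pw_apply]; exact ENNReal.ofReal_pos.2 (qw_nonneg a h0 h1 hc b)

lemma cyl_pos {A : Type*} [MeasurableSpace A] [MeasurableSingletonClass A] (p : Measure A)
    [IsProbabilityMeasure p] (hp : ∀ b, 0 < p {b}) (z : ℤ → A) (g g' : ℤ) :
    0 < iid p {y | ∀ k, g ≤ k → k ≤ g' → y k = z k} := by
  have : {y : ℤ → A | ∀ k, g ≤ k → k ≤ g' → y k = z k}
      = Set.pi (↑(Finset.Icc g g')) (fun k => {z k}) := by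
    ext y; simp [Set.mem_pi]
  rw [this, iid_box p _ _ (fun _ _ => measurableSet_singleton _)]
  exact pos_iff_ne_zero.2 (Finset.prod_ne_zero_iff.2 fun i _ => (hp _).ne')

lemma Psi_full (hn : 0 < n) (hW : ∀ m, W (m + n) = W m) (hW0 : W 0 ≠ a)
    (p : Measure (Col M N)) [IsProbabilityMeasure p] (hp : ∀ b, 0 < p {b})
    {U : Set ↥(SigmaD M N)} (hU : IsOpen U) (hne : U.Nonempty) :
    0 < iid p (Psi a W n ⁻¹' U) := by
  obtain ⟨x, hx⟩ := hne
  obtain ⟨m, hm⟩ := open_cyl hU hx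
  obtain ⟨q, y0, hq, hy0⟩ := full_window x.2 m
  -- the surrounded word
  let z : ℤ → Col M N := fun k =>
    if k = q - n - 1 ∨ k = m + 1 then W 0 else
      if q ≤ k ∧ k ≤ m then y0 k else a
  have hz1 : GM a n z (q - n - 1) := by
    refine ⟨by simp [z, hW0], fun k h1 h2 => ?_⟩
    simp only [z]
    rw [if_neg (by omega), if_neg (by omega)]
  have hz2 : GM a n z (m + 1) := by
    refine ⟨by simp [z, hW0], fun k h1 h2 => ?_⟩
    simp only [z]
    rw [if_neg (by omega), if_neg (by omega)]
  have hz3 : ∀ k, q ≤ k → k ≤ m → z k = y0 k := by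
    intro k h1 h2
    simp only [z]
    rw [if_neg (by omega), if_pos ⟨h1, h2⟩]
  refine (cyl_pos p hp (Phi a W n z) (q - n - 1) (m + 1 + n)).trans_le (measure_mono ?_)
  intro y hy
  apply hm
  intro i h1 h2
  apply hy0 _ _ i h1 h2
  intro k hk1 hk2
  have e := Phi_congr (W := W) hW0 (x := Phi a W n z) (x' := y) (g := q - n - 1) (g' := m + 1)
    (k := k) (by omega) (GM_Phi hz1) (GM_Phi hz2) (fun j h h' => (hy j h h').symm)
    (by omega) (by omega)
  rw [← e, Phi_Phi hn hW hW0, hz3 k hk1 hk2]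

def Good (f : C(↥(SigmaD M N), ℝ)) (b : ℝ) : Prop :=
  ∃ (p : unitInterval → Measure (Col M N)) (_ : ∀ t, IsProbabilityMeasure (p t))
    (Ψ : (ℤ → Col M N) → ↥(SigmaD M N)) (Θ : ↥(SigmaD M N) → (ℤ → Col M N)),
    Measurable p ∧ Function.Injective p ∧ Measurable Ψ ∧ Measurable Θ ∧
    (∀ x, Θ (Ψ x) = x) ∧ (∀ x, Ψ (shift x) = shiftD M N (Ψ x)) ∧
    (∀ t, ∀ U : Set ↥(SigmaD M N), IsOpen U → U.Nonempty → 0 < iid (p t) (Ψ ⁻¹' U)) ∧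
    ∀ t, b ≤ ∫ x, f (Ψ x) ∂(iid (p t))

lemma pw_measurable {A : Type*} [MeasurableSpace A] [Fintype A] [DecidableEq A] (a : A) :
    Measurable (fun δ => pw a δ) := by
  refine Measure.measurable_of_measurable_coe _ fun s hs => ?_
  have : (fun δ => pw a δ s) = fun δ => ∑ b, ENNReal.ofReal (qw a δ b) * Measure.dirac b s := by
    ext δ; simp [pw, Measure.finset_sum_apply]
  rw [this]
  refine Finset.measurable_sum _ fun b _ => Measurable.mul_const ?_ _
  refine ENNReal.measurable_ofReal.comp ?_
  unfold qw
  split_ifs <;> fun_prop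

lemma good_of_Psi (hn : 0 < n) (hW : ∀ m, W (m + n) = W m) (hW0 : W 0 ≠ a)
    (f : C(↥(SigmaD M N), ℝ)) (b : ℝ) {δ0 : ℝ} (h0 : 0 < δ0) (h1 : δ0 < 1)
    (hf : ∀ δ (h0 : 0 < δ) (h1 : δ ≤ δ0), ∀ [IsProbabilityMeasure (pw a δ)],
      b ≤ ∫ x, f (Psi a W n x) ∂(iid (pw a δ))) : Good f b := by
  have hc : 2 ≤ Fintype.card (Col M N) := by
    rw [card_Col]; have := NeZero.pos M; omega
  have d0 : ∀ t : unitInterval, 0 < δ0 * (1 + (t : ℝ)) / 2 := fun t => by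
    have := t.2.1; positivity
  have d1 : ∀ t : unitInterval, δ0 * (1 + (t : ℝ)) / 2 ≤ δ0 := fun t => by
    have := t.2.2; nlinarith
  have hp : ∀ t : unitInterval, IsProbabilityMeasure (pw a (δ0 * (1 + (t : ℝ)) / 2)) :=
    fun t => pw_prob a (d0 t) ((d1 t).trans_lt h1) hc
  refine ⟨fun t => pw a (δ0 * (1 + (t : ℝ)) / 2), hp, Psi a W n, PsiInv a W n, ?_, ?_,
    Psi_meas hW0, PsiInv_meas hW0, PsiInv_Psi hn hW hW0, Psi_shift hW0, ?_, ?_⟩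
  · exact (pw_measurable a).comp (by fun_prop)
  · intro s t hst
    have e : pw a (δ0 * (1 + (s : ℝ)) / 2) {a} = pw a (δ0 * (1 + (t : ℝ)) / 2) {a} :=
      congrArg (fun μ : Measure (Col M N) => μ {a}) hst
    rw [pw_apply, pw_apply, ENNReal.ofReal_eq_ofReal_iff] at e
    · simp only [qw, if_true] at e
      have : δ0 * ((s : ℝ) - t) = 0 := by linarith
      rcases mul_eq_zero.1 this with h | h
      · exact absurd h h0.ne'
      · exact Subtype.ext (by linarith)
    · simp only [qw, if_true]; linarith [d1 s]
    · simp only [qw, if_true]; linarith [d1 t]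
  · intro t U hU hne
    exact Psi_full hn hW hW0 _ (fun b => pw_pos a (d0 t) ((d1 t).trans_lt h1) hc b) hU hne
  · intro t
    exact hf _ (d0 t) (d1 t)

end Fam

/-- Final assembly. -/
theorem final_of_good (M N : ℕ) [NeZero M]
    (H : ∀ (f : C(↥(SigmaD M N), ℝ)) (ε : ℝ), 0 < ε → ∃ b, Good f b ∧
      ∀ ν ∈ InvP (shiftD M N), ∫ x, f x ∂ν ≤ b + ε) :
    ∃ 𝒟 : Set C(↥(SigmaD M N), ℝ), Dense 𝒟 ∧
      ∀ f ∈ 𝒟, ∃ S : Set (ProbabilityMeasure ↥(SigmaD M N)),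
        S ⊆ Mmax M N f ∧ ¬S.Countable ∧
        ∀ μ ∈ S, FullSupp μ ∧ IsBernoulli (shiftD M N) μ.toMeasure := by
  refine ⟨{f | ∃ S : Set (ProbabilityMeasure ↥(SigmaD M N)),
        S ⊆ Mmax M N f ∧ ¬S.Countable ∧
        ∀ μ ∈ S, FullSupp μ ∧ IsBernoulli (shiftD M N) μ.toMeasure}, ?_, fun f hf => hf⟩
  rw [Metric.dense_iff]
  intro f0 r hr
  obtain ⟨b, ⟨p, hp, Ψ, Θ, pm, pinj, hΨ, hΘ, hinv, heq, hfull, hintg⟩, hb⟩ := H f0 (r / 4) (by positivity)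
  have hTm : Measurable (shiftD M N) := shiftD_cont.measurable
  let κ : unitInterval → Measure ↥(SigmaD M N) := fun t => Measure.map Ψ (iid (p t))
  have hκ : Measurable κ := (Measure.measurable_map Ψ hΨ).comp (iid_measurable p pm)
  have hκp : ∀ t, IsProbabilityMeasure (κ t) := fun t =>
    Measure.isProbabilityMeasure_map hΨ.aemeasurable
  have hκe : ∀ t, Ergodic (shiftD M N) (κ t) := fun t => by
    have mp : MeasurePreserving Ψ (iid (p t)) (κ t) := ⟨hΨ, rfl⟩
    exact mp.ergodic_of_ergodic_semiconj (iid_ergodic (p t)) hTm (fun x => heq x)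
  have hΘκ : ∀ t, Measure.map Θ (κ t) = iid (p t) := fun t => by
    simp only [κ]
    rw [Measure.map_map hΘ hΨ]
    have : Θ ∘ Ψ = id := funext hinv
    rw [this, Measure.map_id]
  have hκi : Function.Injective κ := fun s t hst => by
    apply pinj
    apply iid_inj
    rw [← hΘκ, ← hΘκ, hst]
  have hκint : ∀ t, b ≤ ∫ x, f0 x ∂(κ t) := fun t => by
    simp only [κ]
    rw [integral_map hΨ.aemeasurable f0.continuous.aestronglyMeasurable]
    exact hintg t
  obtain ⟨f1, hf1, hunc⟩ := partI shiftD_cont (volume : Measure unitInterval) κ hκ hκp hκe f0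
    (ε := r / 2) (fun ν hν t => by linarith [hb ν hν, hκint t])
  refine ⟨f1, ?_, ?_⟩
  · rw [Metric.mem_ball, dist_eq_norm]; linarith
  refine ⟨(fun t => (⟨κ t, hκp t⟩ : ProbabilityMeasure ↥(SigmaD M N))) ''
    {t | ∀ ν ∈ InvP (shiftD M N), ∫ x, f1 x ∂ν ≤ ∫ x, f1 x ∂(κ t)}, ?_, ?_, ?_⟩
  · rintro _ ⟨t, ht, rfl⟩
    refine ⟨(hκe t).toMeasurePreserving, fun ν hν => ?_⟩
    exact ht ν.toMeasure ⟨inferInstance, hν⟩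
  · intro hc
    apply hunc
    refine Set.countable_of_injective_of_countable_image (Function.Injective.injOn ?_) hc
    intro s t hst
    exact hκi (congrArg (fun μ : ProbabilityMeasure ↥(SigmaD M N) => μ.toMeasure) hst)
  · rintro _ ⟨t, ht, rfl⟩
    refine ⟨fun U hU hne => ?_, ?_⟩
    · show 0 < (Measure.map Ψ (iid (p t))) U
      rw [Measure.map_apply hΨ hU.measurableSet]
      exact hfull t U hU hne
    · exact isBernoulli_of_factor (shiftD M N) (p t) Ψ Θ hΨ hΘ hTm hinv heq
        (sigma_eq_meas (hΨ.comp hΘ))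

/-! ### Part 10 -/

open MeasureTheory Topology Filter ProbabilityTheory
open scoped ENNReal NNReal symmDiff

section Prob
variable {A : Type*} [MeasurableSpace A] [MeasurableSingletonClass A]

def Est (a : A) (n : ℕ) (R : ℕ) (s t : ℕ) : Set (ℤ → A) :=
  Set.pi (↑(Finset.Icc (-(R + n + 1 + s) : ℤ) (R + 1 + t + n)))
    (fun k => if k = -(R + n + 1 + s) ∨ k = R + 1 + t then {a}ᶜ else {a})

lemma Est_meas (a : A) (n R s t : ℕ) : MeasurableSet (Est a n R s t) := by
  unfold Est
  refine MeasurableSet.pi (Finset.countable_toSet _) fun k _ => ?_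
  split_ifs
  · exact (measurableSet_singleton a).compl
  · exact measurableSet_singleton a

lemma Est_val {a : A} {n R s t : ℕ} {x : ℤ → A} (hx : x ∈ Est a n R s t) :
    x (-(R + n + 1 + s)) ≠ a ∧ x (R + 1 + t) ≠ a ∧
    (∀ k : ℤ, -(R + n + 1 + s) < k → k < R + 1 + t → x k = a) ∧
    (∀ k : ℤ, R + 1 + t < k → k ≤ R + 1 + t + n → x k = a) := by
  have h : ∀ k : ℤ, -(R + n + 1 + s : ℤ) ≤ k → k ≤ R + 1 + t + n →
      x k ∈ (if k = -(R + n + 1 + s : ℤ) ∨ k = R + 1 + t then ({a}ᶜ : Set A) else {a}) := by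
    intro k h1 h2
    exact hx k (by simp only [Finset.coe_Icc, Set.mem_Icc]; exact ⟨h1, h2⟩)
  refine ⟨?_, ?_, ?_, ?_⟩
  · have := h (-(R + n + 1 + s)) (by omega) (by omega)
    simpa using this
  · have := h (R + 1 + t) (by omega) (by omega)
    simpa using this
  · intro k h1 h2
    have := h k (by omega) (by omega)
    rw [if_neg (by omega)] at this
    exact this
  · intro k h1 h2
    have := h k (by omega) (by omega)
    rw [if_neg (by omega)] at this
    exact this

lemma Est_disj (a : A) (n R : ℕ) :
    Pairwise (Function.onFun Disjoint (fun st : ℕ × ℕ => Est a n R st.1 st.2)) := by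
  rintro ⟨s, t⟩ ⟨s', t'⟩ hne
  rw [Function.onFun, Set.disjoint_left]
  intro x h h'
  apply hne
  obtain ⟨a1, a2, a3, a4⟩ := Est_val h
  obtain ⟨b1, b2, b3, b4⟩ := Est_val h'
  have e1 : s = s' := by
    rcases lt_trichotomy s s' with q | q | q
    · exact absurd (b3 _ (by omega) (by omega)) a1
    · exact q
    · exact absurd (a3 _ (by omega) (by omega)) b1
  have e2 : t = t' := by
    rcases lt_trichotomy t t' with q | q | q
    · exact absurd (b3 _ (by omega) (by omega)) a2
    · exact q
    · exact absurd (a3 _ (by omega) (by omega)) b2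
  rw [e1, e2]

lemma Est_prob (p : Measure A) [IsProbabilityMeasure p] (a : A) (n R s t : ℕ) :
    iid p (Est a n R s t) = p {a}ᶜ ^ 2 * p {a} ^ (2 * R + 2 * n + 1 + s + t) := by
  unfold Est
  rw [iid_box]
  swap
  · intro k _
    split_ifs
    · exact (measurableSet_singleton a).compl
    · exact measurableSet_singleton a
  have : ∀ k ∈ Finset.Icc (-(R + n + 1 + s) : ℤ) (R + 1 + t + n),
      p (if k = -(R + n + 1 + s : ℤ) ∨ k = R + 1 + t then {a}ᶜ else {a})
      = if k = -(R + n + 1 + s : ℤ) ∨ k = R + 1 + t then p {a}ᶜ else p {a} := by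
    intro k _; split_ifs <;> rfl
  rw [Finset.prod_congr rfl this, Finset.prod_ite, Finset.prod_const, Finset.prod_const]
  have e1 : (Finset.Icc (-(R + n + 1 + s) : ℤ) (R + 1 + t + n)).filter
      (fun k => k = -(R + n + 1 + s : ℤ) ∨ k = R + 1 + t) = {-(R + n + 1 + s : ℤ), (R + 1 + t : ℤ)} := by
    ext k; simp only [Finset.mem_filter, Finset.mem_Icc, Finset.mem_insert, Finset.mem_singleton]
    omega
  have c1 := Finset.card_filter_add_card_filter_not (s := Finset.Icc (-(R + n + 1 + s) : ℤ) (R + 1 + t + n))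
    (fun k => k = -(R + n + 1 + s : ℤ) ∨ k = R + 1 + t)
  have c2 : ({-(R + n + 1 + s : ℤ), (R + 1 + t : ℤ)} : Finset ℤ).card = 2 :=
    Finset.card_pair (by omega)
  rw [e1, c2, Int.card_Icc] at c1
  rw [e1, c2]
  congr 2
  omega

def EE (a : A) (n R : ℕ) : Set (ℤ → A) := ⋃ st : ℕ × ℕ, Est a n R st.1 st.2

lemma EE_meas (a : A) (n R : ℕ) : MeasurableSet (EE a n R) :=
  MeasurableSet.iUnion fun _ => Est_meas _ _ _ _ _

lemma EE_prob [Fintype A] [DecidableEq A] (a : A) {δ : ℝ} (h0 : 0 < δ) (h1 : δ < 1)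
    (hc : 2 ≤ Fintype.card A) [IsProbabilityMeasure (pw a δ)] (n R : ℕ) :
    iid (pw a δ) (EE a n R) = ENNReal.ofReal ((1 - δ) ^ (2 * R + 2 * n + 1)) := by
  unfold EE
  rw [measure_iUnion (Est_disj a n R) (fun _ => Est_meas _ _ _ _ _)]
  simp_rw [Est_prob]
  rw [pw_compl a h0 h1 hc, pw_apply]
  simp only [qw, if_true]
  rw [ENNReal.ofReal_pow (by linarith)]
  set q := ENNReal.ofReal (1 - δ) with hq
  have hq1 : q < 1 := by
    rw [hq, ← ENNReal.ofReal_one]; exact (ENNReal.ofReal_lt_ofReal_iff one_pos).2 (by linarith)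
  have hd : (1 - q) ≠ 0 := (tsub_pos_of_lt hq1).ne'
  have hd' : (1 - q) ≠ ⊤ := (lt_of_le_of_lt tsub_le_self ENNReal.one_lt_top).ne
  rw [ENNReal.tsum_prod']
  simp only [pow_add _ _ _, ← mul_assoc]
  simp_rw [ENNReal.tsum_mul_left, ENNReal.tsum_geometric]
  simp_rw [ENNReal.tsum_mul_right, ENNReal.tsum_mul_left, ENNReal.tsum_geometric]
  calc _ = ((1 - q) * (1 - q)⁻¹) * ((1 - q) * (1 - q)⁻¹) * (q ^ (2 * R) * q ^ (2 * n) * q ^ 1) := by ring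
    _ = _ := by rw [ENNReal.mul_inv_cancel hd hd', one_mul, one_mul]

end Prob

lemma Phi_on_EE {A : Type*} [MeasurableSpace A] [MeasurableSingletonClass A]
    {a : A} {W : ℤ → A} {n R : ℕ} (hW0 : W 0 ≠ a) {x : ℤ → A}
    (hx : x ∈ EE a n R) : ∃ d : ℤ, ∀ k : ℤ, -R ≤ k → k ≤ R → Phi a W n x k = W (k + d) := by
  obtain ⟨⟨s, t⟩, hx⟩ := Set.mem_iUnion.1 hx
  obtain ⟨a1, a2, a3, a4⟩ := Est_val hx
  simp only at a1 a2 a3 a4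
  refine ⟨R + s, fun k h1 h2 => ?_⟩
  have := Phi_eq (n := n) hW0 (x := x) (k := k) (b := W (k + (R + s)))
    ⟨-(R + n + 1 + s), R + 1 + t, ⟨⟨a1, fun k h h' => a3 k h (by omega)⟩, ⟨a2, a4⟩, by omega,
      fun m h h' hm => hm.1 (a3 m h h')⟩, by omega, by omega,
      Or.inl ⟨fun k h h' => a3 k (by omega) (by omega), by congr 1; ring⟩⟩
  exact this

section Int
variable {M N : ℕ} [NeZero M] {a : Col M N} {W : ℤ → Col M N} {n : ℕ} 

lemma Psi_iter (hW0 : W 0 ≠ a) (x : ℤ → Col M N) (s : ℕ) :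
    Psi a W n (shift^[s] x) = (shiftD M N)^[s] (Psi a W n x) := by
  induction s with
  | zero => rfl
  | succ s ih => rw [Function.iterate_succ_apply', Function.iterate_succ_apply', Psi_shift hW0, ih]

lemma good_core (hn : 0 < n) (hW : ∀ m, W (m + n) = W m) (hW0 : W 0 ≠ a)
    (f : C(↥(SigmaD M N), ℝ)) (c : ℝ) (R : ℕ)
    (hR : ∀ (z : ℤ → Col M N) (d : ℤ), (∀ k : ℤ, -R ≤ k → k ≤ R → z k = W (k + d)) →
      c * n ≤ ∑ s ∈ Finset.range n, f ((shiftD M N)^[s] (lift z)))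
    {b : ℝ} (hb : b < c) : Good f b := by
  have hc : 2 ≤ Fintype.card (Col M N) := by
    rw [card_Col]; have := NeZero.pos M; omega
  have hF : ∀ x, -‖f‖ ≤ f x := fun x => (abs_le.1 (f.norm_coe_le_norm x)).1
  -- choice of δ0
  have hlim : Tendsto (fun δ : ℝ => (1 - δ) ^ (2 * R + 2 * n + 1) * (c + ‖f‖)) (𝓝 0)
      (𝓝 ((1 - 0) ^ (2 * R + 2 * n + 1) * (c + ‖f‖))) :=
    Continuous.tendsto (by fun_prop) 0
  have hev := hlim.eventually (lt_mem_nhds (a := b + ‖f‖) (by simpa using hb))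
  obtain ⟨r, hr, hr'⟩ := Metric.eventually_nhds_iff.1 hev
  refine good_of_Psi hn hW hW0 f b (δ0 := min (r / 2) (1 / 2)) (by positivity)
    (lt_of_le_of_lt (min_le_right _ _) (by norm_num)) ?_
  intro δ h0 h1 hprob
  have hδ1 : δ < 1 := lt_of_le_of_lt (h1.trans (min_le_right _ _)) (by norm_num)
  have hδ := hr' (y := δ) (by
    rw [Real.dist_eq, sub_zero, abs_of_pos h0]
    exact lt_of_le_of_lt (h1.trans (min_le_left _ _)) (by linarith))
  set μ := iid (pw a δ) with hμ
  have hΨ : Measurable (Psi a W n) := Psi_meas hW0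
  have hbd : ∀ x, ‖f x‖ ≤ ‖f‖ := f.norm_coe_le_norm
  have hi : ∀ s : ℕ, Integrable (fun x => f (Psi a W n (shift^[s] x))) μ := by
    intro s
    refine Integrable.of_bound (C := ‖f‖) ?_ (Eventually.of_forall fun x => hbd _)
    refine (f.continuous.measurable.comp (hΨ.comp ?_)).aestronglyMeasurable
    exact ((iid_ergodic (pw a δ)).toMeasurePreserving.iterate s).measurable
  have hst : ∀ s : ℕ, ∫ x, f (Psi a W n (shift^[s] x)) ∂μ = ∫ x, f (Psi a W n x) ∂μ := by
    intro s
    have mp := (iid_ergodic (pw a δ)).toMeasurePreserving.iterate s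
    have := integral_map (μ := μ) mp.measurable.aemeasurable (f := fun x => f (Psi a W n x))
      (f.continuous.measurable.comp hΨ).aestronglyMeasurable
    rw [mp.map_eq] at this
    exact this.symm
  by_cases hcF : c + ‖f‖ < 0
  · have : ∫ x, (-‖f‖) ∂μ ≤ ∫ x, f (Psi a W n x) ∂μ :=
      integral_mono (integrable_const _) (hi 0) (fun x => hF _)
    rw [integral_const] at this
    simp at this
    linarith
  push Not at hcF
  have hnR : (0 : ℝ) < n := by exact_mod_cast hn
  have hi' : ∀ s ∈ Finset.range n,
      Integrable (fun x => f (Psi a W n (shift^[s] x)) + ‖f‖) μ :=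
    fun s _ => (hi s).add (integrable_const _)
  have key : ∫ x, ((EE a n R).indicator (fun _ => (c + ‖f‖) * n) x) ∂μ
      ≤ ∫ x, (∑ s ∈ Finset.range n, (f (Psi a W n (shift^[s] x)) + ‖f‖)) ∂μ := by
    refine integral_mono ?_ ?_ ?_
    · exact (integrable_const _).indicator (EE_meas a n R)
    · exact integrable_finset_sum _ fun s _ => (hi s).add (integrable_const _)
    · intro x
      simp only [Set.indicator]
      split_ifs with hx
      · obtain ⟨d, hd⟩ := Phi_on_EE (W := W) hW0 hx
        have := hR _ d hd
        rw [Finset.sum_add_distrib, Finset.sum_const, Finset.card_range, nsmul_eq_mul]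
        simp_rw [Psi_iter hW0]
        have e : Psi a W n x = lift (Phi a W n x) := rfl
        rw [e]; linarith
      · exact Finset.sum_nonneg fun s _ => by linarith [hF (Psi a W n (shift^[s] x))]
  rw [integral_indicator (EE_meas a n R), setIntegral_const,
    integral_finset_sum _ hi'] at key
  have hP : μ.real (EE a n R) = (1 - δ) ^ (2 * R + 2 * n + 1) := by
    rw [Measure.real, hμ, EE_prob a h0 hδ1 hc, ENNReal.toReal_ofReal (by
      have : 0 ≤ 1 - δ := by linarith
      positivity)]
  rw [hP] at key
  have : ∀ s ∈ Finset.range n, ∫ x, (f (Psi a W n (shift^[s] x)) + ‖f‖) ∂μ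
      = ∫ x, f (Psi a W n x) ∂μ + ‖f‖ := by
    intro s _
    rw [integral_add (hi s) (integrable_const _), hst s, integral_const]
    simp
  rw [Finset.sum_congr rfl this, Finset.sum_const, Finset.card_range, nsmul_eq_mul, smul_eq_mul] at key
  have : (1 - δ) ^ (2 * R + 2 * n + 1) * (c + ‖f‖) ≤ ∫ x, f (Psi a W n x) ∂μ + ‖f‖ := by
    refine le_of_mul_le_mul_left ?_ hnR
    linarith
  linarith

end Int

/-! ### Part 11 -/

open MeasureTheory Topology Filter ProbabilityTheory
open scoped ENNReal NNReal symmDiff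

lemma left_match_ge {c : ℤ → ℤ} (hc : ∀ n, c n ≤ 1) {j p : ℤ} (hj : c j = -1) (hpj : p ≤ j)
    (hp : ht c p ≤ ht c (j + 1)) : ∃ i, p ≤ i ∧ Mat c i j := by
  obtain ⟨i, ⟨h0, h1, h2⟩, h3⟩ := Int.exists_greatest_of_bdd
    (P := fun i => p ≤ i ∧ i ≤ j ∧ ht c i ≤ ht c (j + 1)) ⟨j, fun z hz => hz.2.1⟩ ⟨p, le_rfl, hpj, hp⟩
  have hsj := ht_succ c j
  have hij : i < j := by
    rcases eq_or_lt_of_le h1 with rfl | h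
    · omega
    · exact h
  have hgt : ∀ m, i < m → m ≤ j → ht c (j + 1) < ht c m := by
    intro m hm hmj
    by_contra hcon
    have := h3 m ⟨by omega, hmj, by omega⟩
    omega
  have hs := ht_succ c i
  have hg := hgt (i + 1) (by omega) (by omega)
  have hci := hc i
  refine ⟨i, h0, hij, by omega, fun m hm hmj => ?_⟩
  have := hgt m hm hmj
  omega

section A
variable {M N : ℕ}

lemma DMSym.val_le1 (s : DMSym M N) : s.val ≤ 1 := by cases s <;> simp [DMSym.val]

lemma shiftD_iter (x : ↥(SigmaD M N)) (s : ℕ) (i : ℤ) :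
    ((shiftD M N)^[s] x).1 i = x.1 (i + s) := by
  induction s generalizing i with
  | zero => simp
  | succ s ih =>
    rw [Function.iterate_succ_apply']
    show ((shiftD M N)^[s] x).1 (i + 1) = _
    rw [ih, show i + 1 + (s : ℤ) = i + ((s + 1 : ℕ) : ℤ) by push_cast; ring]

variable [NeZero M]

lemma sum_rot (n : ℕ) (hn : 0 < n) (d : ℤ) (G : ℕ → ℝ) :
    ∑ s ∈ Finset.range n, G (((s : ℤ) + d) % n).toNat = ∑ j ∈ Finset.range n, G j := by
  have hn' : (n : ℤ) ≠ 0 := by omega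
  have hpos : (0 : ℤ) < n := by omega
  have h1 : ∀ z : ℤ, 0 ≤ z % n := fun z => Int.emod_nonneg _ hn'
  have h2 : ∀ z : ℤ, z % n < n := fun z => Int.emod_lt_of_pos _ hpos
  refine Finset.sum_nbij' (fun s => (((s : ℤ) + d) % n).toNat) (fun j => (((j : ℤ) - d) % n).toNat)
    ?_ ?_ ?_ ?_ ?_
  · intro s _; have := h1 (s + d); have := h2 (s + d); simp only [Finset.mem_range]; omega
  · intro s _; have := h1 (s - d); have := h2 (s - d); simp only [Finset.mem_range]; omega
  · intro s hs
    simp only [Finset.mem_range] at hs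
    rw [Int.toNat_of_nonneg (h1 _), Int.emod_sub_emod, add_sub_cancel_right,
      Int.emod_eq_of_lt (by omega) (by omega)]
    simp
  · intro s hs
    simp only [Finset.mem_range] at hs
    rw [Int.toNat_of_nonneg (h1 _), Int.emod_add_emod, sub_add_cancel,
      Int.emod_eq_of_lt (by omega) (by omega)]
    simp
  · intro s _; rfl

lemma bad_count (n m : ℕ) {F : ℝ} (hF : 0 ≤ F) :
    ∑ j ∈ Finset.range n, (if m ≤ j ∧ j + m < n then (0 : ℝ) else 2 * F) ≤ 4 * m * F := by
  rw [Finset.sum_ite, Finset.sum_const_zero, zero_add, Finset.sum_const, nsmul_eq_mul]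
  have hsub : (Finset.range n).filter (fun j => ¬ (m ≤ j ∧ j + m < n)) ⊆
      Finset.range m ∪ Finset.Ico (n - m) n := by
    intro j hj
    simp only [Finset.mem_filter, Finset.mem_range, Finset.mem_union, Finset.mem_Ico] at *
    omega
  have h1 := (Finset.card_le_card hsub).trans (Finset.card_union_le _ _)
  rw [Finset.card_range, Nat.card_Ico] at h1
  have h2 : ((Finset.range n).filter (fun j => ¬ (m ≤ j ∧ j + m < n))).card ≤ 2 * m := by omega
  have h3 : (((Finset.range n).filter (fun j => ¬ (m ≤ j ∧ j + m < n))).card : ℝ) ≤ 2 * m := by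
    exact_mod_cast h2
  nlinarith

lemma goodA (f : C(↥(SigmaD M N), ℝ)) {η : ℝ} (m : ℕ)
    (hm : ∀ x y : ↥(SigmaD M N), (∀ i : ℤ, -m ≤ i → i ≤ m → y.1 i = x.1 i) → |f y - f x| < η)
    (x : ↥(SigmaD M N)) (n : ℕ) (hn : 0 < n)
    (hx : ∀ i : ℤ, 0 ≤ i → i ≤ n → ht (cv x.1) 0 ≤ ht (cv x.1) i) {b : ℝ}
    (hb : b * n < ∑ j ∈ Finset.range n, f ((shiftD M N)^[j] x) - n * η - 4 * m * ‖f‖) :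
    Good f b := by
  have hc : 2 ≤ Fintype.card (Col M N) := by
    rw [card_Col]; have := NeZero.pos M; omega
  have hn' : (n : ℤ) ≠ 0 := by omega
  have hpos : (0 : ℤ) < n := by omega
  have hnR : (0 : ℝ) < n := by exact_mod_cast hn
  let W : ℤ → Col M N := fun k => col (x.1 (k % n))
  have hW : ∀ k, W (k + n) = W k := fun k => by simp [W]
  obtain ⟨a, ha⟩ : ∃ a : Col M N, W 0 ≠ a := by
    have : Nontrivial (Col M N) := Fintype.one_lt_card_iff_nontrivial.1 (by omega)
    obtain ⟨a, ha⟩ := exists_ne (W 0)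
    exact ⟨a, ha.symm⟩
  refine good_core (a := a) (W := W) (n := n) hn hW ha f
    ((∑ j ∈ Finset.range n, f ((shiftD M N)^[j] x) - n * η - 4 * m * ‖f‖) / n) (2 * n) ?_
    ((lt_div_iff₀ hnR).2 hb)
  intro z d hz
  rw [div_mul_cancel₀ _ hnR.ne']
  have hη : 0 < η := lt_of_le_of_lt (abs_nonneg _) (hm x x fun _ _ _ => rfl)
  let G : ℕ → ℝ := fun j => f ((shiftD M N)^[j] x) - η - (if m ≤ j ∧ j + m < n then (0 : ℝ) else 2 * ‖f‖)
  have hG : ∑ j ∈ Finset.range n, f ((shiftD M N)^[j] x) - n * η - 4 * m * ‖f‖ ≤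
      ∑ j ∈ Finset.range n, G j := by
    simp only [G]
    rw [Finset.sum_sub_distrib, Finset.sum_sub_distrib, Finset.sum_const, Finset.card_range,
      nsmul_eq_mul]
    have := bad_count n m (norm_nonneg f)
    linarith
  refine hG.trans ?_
  rw [← sum_rot n hn d G]
  refine Finset.sum_le_sum fun s hs => ?_
  rw [Finset.mem_range] at hs
  set j : ℕ := (((s : ℤ) + d) % n).toNat with hj
  have hj0 : (j : ℤ) = ((s : ℤ) + d) % n := Int.toNat_of_nonneg (Int.emod_nonneg _ hn')
  have hjn : (j : ℤ) < n := by rw [hj0]; exact Int.emod_lt_of_pos _ hpos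
  simp only [G]
  split_ifs with hgood
  · have key := hm ((shiftD M N)^[j] x) ((shiftD M N)^[s] (lift z)) (by
      intro i h1 h2
      rw [shiftD_iter, shiftD_iter]
      have hq : (s : ℤ) + d = n * (((s : ℤ) + d) / n) + j := by
        rw [hj0]; exact (Int.mul_ediv_add_emod _ _).symm
      set q := ((s : ℤ) + d) / n
      have hwin := liftF_window x.2 (y := z) (p := 0) (j := i + j) (d := s - j) (by omega) (by
        intro k hk1 hk2
        rw [hz _ (by push_cast; omega) (by push_cast; omega)]
        simp only [W]
        have : k + ((s : ℤ) - j) + d = k + n * q := by linarith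
        rw [this, Int.add_mul_emod_self_left, Int.emod_eq_of_lt hk1 (by omega)]) (by
        intro l hl
        refine left_match_ge (fun k => DMSym.val_le1 _) (by simp [hl, DMSym.val]) (by omega) ?_
        exact hx _ (by omega) (by omega))
      rw [← hwin]
      show liftF z (i + s) = _
      rw [show i + (j : ℤ) + (s - j) = i + s by ring])
    have := (abs_lt.1 key).1
    linarith
  · have h1 := (abs_le.1 (f.norm_coe_le_norm ((shiftD M N)^[j] x))).2
    have h2 := (abs_le.1 (f.norm_coe_le_norm ((shiftD M N)^[s] (lift z)))).1
    linarith

lemma good_bot (f : C(↥(SigmaD M N), ℝ)) : Good f (-‖f‖ - 1) := by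
  have hc : 2 ≤ Fintype.card (Col M N) := by
    rw [card_Col]; have := NeZero.pos M; omega
  have : Nontrivial (Col M N) := Fintype.one_lt_card_iff_nontrivial.1 (by omega)
  obtain ⟨w, a, hwa⟩ := exists_pair_ne (Col M N)
  refine good_core (a := a) (W := fun _ => w) (n := 1) one_pos (fun _ => rfl) hwa f (-‖f‖) 0 ?_
    (by linarith)
  intro z d _
  simp only [Finset.sum_range_one, Nat.cast_one, mul_one]
  exact (abs_le.1 (f.norm_coe_le_norm _)).1

lemma good_le {f : C(↥(SigmaD M N), ℝ)} {b : ℝ} (h : Good f b) : b ≤ ‖f‖ := by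
  obtain ⟨p, hp, Ψ, Θ, pm, pinj, hΨ, hΘ, hinv, heq, hfull, hintg⟩ := h
  refine (hintg 0).trans ?_
  have : ∫ x, f (Ψ x) ∂(iid (p 0)) ≤ ∫ x, ‖f‖ ∂(iid (p 0)) := by
    refine integral_mono ?_ (integrable_const _) (fun x => (abs_le.1 (f.norm_coe_le_norm _)).2)
    exact Integrable.of_bound (C := ‖f‖)
      (f.continuous.measurable.comp hΨ).aestronglyMeasurable
      (Eventually.of_forall fun x => f.norm_coe_le_norm _)
  simpa using this

end A

/-! ### Part 12 -/

open MeasureTheory Topology Filter ProbabilityTheory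
open scoped ENNReal NNReal symmDiff

section Rev
variable {M N : ℕ}

def DMSym.flip : DMSym M N → DMSym M N
  | .la k => .ra k
  | .u k => .u k
  | .ra k => .la k

lemma DMSym.flip_flip (s : DMSym M N) : s.flip.flip = s := by cases s <;> rfl
lemma DMSym.val_flip (s : DMSym M N) : s.flip.val = -s.val := by cases s <;> rfl

lemma flip_mem {x : ℤ → DMSym M N} (hx : x ∈ SigmaD M N) :
    (fun i => (x (-i)).flip) ∈ SigmaD M N := by
  rw [mem_SigmaD_iff] at *
  intro i j k l hm hi hj
  have e : cv (fun i => (x (-i)).flip) = fun k => -(cv x) (-k) := by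
    funext k; simp [cv, DMSym.val_flip]
  rw [e] at hm
  have hm' : Mat (cv x) (-j) (-i) := by
    rw [← Mat_rev]; simpa using hm
  have hi' : x (-i) = .ra k := by rw [← DMSym.flip_flip (x (-i))]; exact congrArg DMSym.flip hi
  have hj' : x (-j) = .la l := by rw [← DMSym.flip_flip (x (-j))]; exact congrArg DMSym.flip hj
  exact (hx _ _ _ _ hm' hj' hi').symm

def rho (x : ↥(SigmaD M N)) : ↥(SigmaD M N) := ⟨fun i => (x.1 (-i)).flip, flip_mem x.2⟩

lemma rho_rho (x : ↥(SigmaD M N)) : rho (rho x) = x := by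
  apply Subtype.ext; funext i; simp [rho, DMSym.flip_flip]

lemma rho_cont : Continuous (rho : ↥(SigmaD M N) → ↥(SigmaD M N)) := by
  refine Continuous.subtype_mk ?_ _
  refine continuous_pi fun i => ?_
  have hc : Continuous (fun y : ↥(SigmaD M N) => y.1 (-i)) :=
    (continuous_apply (-i)).comp continuous_subtype_val
  exact (continuous_of_discreteTopology (f := DMSym.flip)).comp hc

lemma shiftD_inj : Function.Injective (shiftD M N) := by
  intro x y h
  apply Subtype.ext; funext i
  have := congrArg (fun z : ↥(SigmaD M N) => z.1 (i - 1)) h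
  simpa [shiftD, shift] using this

lemma shift_rho_shift (x : ↥(SigmaD M N)) : shiftD M N (rho (shiftD M N x)) = rho x := by
  apply Subtype.ext; funext i
  simp only [rho, shiftD, shift]
  rw [show -(i + 1) + 1 = -i by ring]

variable [NeZero M]

def rev {A : Type*} (x : ℤ → A) : ℤ → A := fun i => x (-i)

lemma good_rev {f : C(↥(SigmaD M N), ℝ)} {b : ℝ} (h : Good (f.comp ⟨rho, rho_cont⟩) b) : Good f b := by
  obtain ⟨p, hp, Ψ, Θ, pm, pinj, hΨ, hΘ, hinv, heq, hfull, hintg⟩ := h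
  have hrev : ∀ t, MeasurePreserving rev (iid (p t)) (iid (p t)) := fun t =>
    iid_reindex (p t) (Equiv.neg ℤ)
  have hrr : ∀ x : ℤ → Col M N, rev (rev x) = x := fun x => by funext i; simp [rev]
  have hrm : Measurable (rev : (ℤ → Col M N) → _) := (hrev 0).measurable
  have hρ : Measurable (rho : ↥(SigmaD M N) → ↥(SigmaD M N)) := rho_cont.measurable
  refine ⟨p, hp, fun x => rho (Ψ (rev x)), fun x => rev (Θ (rho x)), pm, pinj,
    hρ.comp (hΨ.comp hrm), hrm.comp (hΘ.comp hρ), ?_, ?_, ?_, ?_⟩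
  · intro x; simp only [rho_rho, hinv, hrr]
  · intro x
    have e : shift (rev (shift x)) = rev x := by funext i; simp only [rev, shift]; rw [show -(i + 1) + 1 = -i by ring]
    show rho (Ψ (rev (shift x))) = shiftD M N (rho (Ψ (rev x)))
    rw [← e, heq, shift_rho_shift]
  · intro t U hU hne
    have h1 := hfull t (rho ⁻¹' U) (hU.preimage rho_cont) (by
      obtain ⟨x, hx⟩ := hne
      exact ⟨rho x, by simpa [rho_rho] using hx⟩)
    have h2 := (hrev t).measure_preimage (s := Ψ ⁻¹' (rho ⁻¹' U))
      (hΨ (hρ hU.measurableSet)).nullMeasurableSet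
    rw [← h2] at h1
    exact h1
  · intro t
    have h1 := integral_map (μ := iid (p t)) hrm.aemeasurable (f := fun x => f (rho (Ψ x)))
      (f.continuous.measurable.comp (hρ.comp hΨ)).aestronglyMeasurable
    rw [(hrev t).map_eq] at h1
    have := hintg t
    simp only [ContinuousMap.comp_apply, ContinuousMap.coe_mk] at this
    rw [h1] at this
    exact this

lemma goodB (f : C(↥(SigmaD M N), ℝ)) {η : ℝ} (m : ℕ)
    (hm : ∀ x y : ↥(SigmaD M N), (∀ i : ℤ, -m ≤ i → i ≤ m → y.1 i = x.1 i) → |f y - f x| < η)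
    (x : ↥(SigmaD M N)) (n : ℕ) (hn : 0 < n)
    (hx : ∀ i : ℤ, 0 ≤ i → i ≤ n → ht (cv x.1) n ≤ ht (cv x.1) i) {b : ℝ}
    (hb : b * n < ∑ j ∈ Finset.range n, f ((shiftD M N)^[j] x) - n * η - 4 * m * ‖f‖) :
    Good f b := by
  apply good_rev
  have hnorm : ‖f.comp ⟨rho, rho_cont⟩‖ ≤ ‖f‖ := by
    rw [ContinuousMap.norm_le _ (norm_nonneg f)]
    intro y; exact f.norm_coe_le_norm _
  refine goodA (f.comp ⟨rho, rho_cont⟩) (η := η) m ?_ (rho ((shiftD M N)^[n - 1] x)) n hn ?_ ?_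
  · intro x y hxy
    apply hm
    intro i h1 h2
    simp only [ContinuousMap.coe_mk, rho]
    rw [hxy (-i) (by omega) (by omega)]
  · intro i h1 h2
    have hval : ∀ k, (rho ((shiftD M N)^[n - 1] x)).1 k = (x.1 (n - 1 - k)).flip := by
      intro k
      simp only [rho, shiftD_iter]
      rw [show -k + ((n - 1 : ℕ) : ℤ) = n - 1 - k by omega]
    have := ht_pot (c := cv (rho ((shiftD M N)^[n - 1] x)).1) (H := fun k => ht (cv x.1) (n - k))
      (i := 0) (j := n) (by
        intro k _ _
        have e := ht_succ (cv x.1) (n - (k + 1))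
        rw [show (n : ℤ) - (k + 1) + 1 = n - k by ring] at e
        simp only [cv, hval, DMSym.val_flip] at *
        rw [e, show (n : ℤ) - 1 - k = n - (k + 1) by ring]; ring) i h1 (by omega)
    have h3 := hx (n - i) (by omega) (by omega)
    simp only [sub_zero] at this
    omega
  · have e : ∑ j ∈ Finset.range n, (f.comp ⟨rho, rho_cont⟩) ((shiftD M N)^[j] (rho ((shiftD M N)^[n - 1] x)))
        = ∑ j ∈ Finset.range n, f ((shiftD M N)^[j] x) := by
      rw [← Finset.sum_range_reflect]
      refine Finset.sum_congr rfl fun j hj => ?_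
      rw [Finset.mem_range] at hj
      simp only [ContinuousMap.comp_apply, ContinuousMap.coe_mk]
      congr 1
      apply Subtype.ext; funext i
      simp only [rho, shiftD_iter, DMSym.flip_flip]
      rw [show -(-i + ((n - 1 - j : ℕ) : ℤ)) + ((n - 1 : ℕ) : ℤ) = i + j by omega]
    rw [e]
    have : 4 * (m : ℝ) * ‖f.comp ⟨rho, rho_cont⟩‖ ≤ 4 * m * ‖f‖ := by gcongr
    linarith

lemma select (f : C(↥(SigmaD M N), ℝ)) {ν : Measure ↥(SigmaD M N)} (hν : ν ∈ InvP (shiftD M N))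
    {γ b : ℝ} (hγ : γ < ∫ x, f x ∂ν) (hb : b < γ) : Good f b := by
  obtain ⟨hp, hmp⟩ := hν
  set η := (γ - b) / 2 with hη
  have hη0 : 0 < η := by rw [hη]; linarith
  obtain ⟨m, hm⟩ := unif_cyl f hη0
  set C := 4 * m * ‖f‖ with hC
  have hC0 : 0 ≤ C := by positivity
  obtain ⟨n, hn⟩ := exists_nat_gt (2 * C / η)
  have hn2 : 2 * C < n * η := (div_lt_iff₀ hη0).1 hn
  have hn0R : (0 : ℝ) < n := lt_of_le_of_lt (by positivity) hn
  have hn0 : 0 < n := by exact_mod_cast hn0R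
  -- a point with large Birkhoff sum
  obtain ⟨x, hx⟩ : ∃ x, n * γ < ∑ j ∈ Finset.range n, f ((shiftD M N)^[j] x) := by
    by_contra hcon
    push Not at hcon
    have hi : ∀ s ∈ Finset.range n, Integrable (fun x => f ((shiftD M N)^[s] x)) ν := fun s _ =>
      Integrable.of_bound (C := ‖f‖)
        (f.continuous.comp (shiftD_cont.iterate s)).aestronglyMeasurable
        (Eventually.of_forall fun x => f.norm_coe_le_norm _)
    have h1 : ∫ x, (∑ j ∈ Finset.range n, f ((shiftD M N)^[j] x)) ∂ν ≤ ∫ x, (n * γ) ∂ν :=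
      integral_mono (integrable_finset_sum _ hi) (integrable_const _) hcon
    rw [integral_finset_sum _ hi, integral_const] at h1
    have h2 : ∀ s ∈ Finset.range n, ∫ x, f ((shiftD M N)^[s] x) ∂ν = ∫ x, f x ∂ν := fun s _ => by
      have mp := hmp.iterate s
      have := integral_map (μ := ν) mp.measurable.aemeasurable (f := f)
        f.continuous.aestronglyMeasurable
      rw [mp.map_eq] at this
      exact this.symm
    rw [Finset.sum_congr rfl h2, Finset.sum_const, Finset.card_range, nsmul_eq_mul] at h1
    simp at h1
    have := lt_of_mul_lt_mul_left (a := (n : ℝ)) (b := ∫ x, f x ∂ν) (c := γ + 1) (by nlinarith) hn0R.le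
    nlinarith
  -- minimum of the height
  obtain ⟨k0, hk0, hmin⟩ := Finset.exists_min_image (Finset.range (n + 1))
    (fun k : ℕ => ht (cv x.1) k) ⟨0, by simp⟩
  rw [Finset.mem_range] at hk0
  have hmin' : ∀ i : ℤ, 0 ≤ i → i ≤ n → ht (cv x.1) k0 ≤ ht (cv x.1) i := by
    intro i h1 h2
    have := hmin i.toNat (by rw [Finset.mem_range]; omega)
    simpa [Int.toNat_of_nonneg h1] using this
  by_contra hng
  have hB : ∑ j ∈ Finset.range k0, f ((shiftD M N)^[j] x) ≤ b * k0 + k0 * η + C := by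
    rcases Nat.eq_zero_or_pos k0 with h | h
    · simp [h, hC0]
    · by_contra hcon
      apply hng
      exact goodB f m hm x k0 h (fun i h1 h2 => hmin' i h1 (by omega)) (by linarith)
  have hA : ∑ j ∈ Finset.range (n - k0), f ((shiftD M N)^[j] ((shiftD M N)^[k0] x)) ≤
      b * (n - k0 : ℕ) + (n - k0 : ℕ) * η + C := by
    rcases Nat.eq_zero_or_pos (n - k0) with h | h
    · simp [h, hC0]
    · by_contra hcon
      apply hng
      refine goodA f m hm ((shiftD M N)^[k0] x) (n - k0) h (fun i h1 h2 => ?_) (by linarith)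
      have := ht_pot (c := cv ((shiftD M N)^[k0] x).1) (H := fun k => ht (cv x.1) (k + k0))
        (i := 0) (j := n) (by
          intro k _ _
          have e := ht_succ (cv x.1) (k + k0)
          simp only [cv, shiftD_iter] at *
          rw [show k + 1 + (k0 : ℤ) = k + k0 + 1 by ring, e]) i h1 (by omega)
      have h3 := hmin' (i + k0) (by omega) (by omega)
      simp only [zero_add] at this
      omega
  have hsplit : ∑ j ∈ Finset.range n, f ((shiftD M N)^[j] x) =
      ∑ j ∈ Finset.range k0, f ((shiftD M N)^[j] x) +
      ∑ j ∈ Finset.range (n - k0), f ((shiftD M N)^[j] ((shiftD M N)^[k0] x)) := by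
    have e : n = k0 + (n - k0) := by omega
    conv_lhs => rw [e]
    rw [Finset.sum_range_add]
    congr 1
    refine Finset.sum_congr rfl fun j _ => ?_
    rw [add_comm k0 j, Function.iterate_add_apply]
  have hcast : ((n - k0 : ℕ) : ℝ) = n - k0 := by
    rw [Nat.cast_sub (by omega)]
  rw [hcast] at hA
  have : (n : ℝ) * γ < n * (b + η) + 2 * C := by nlinarith
  have : (n : ℝ) * γ = n * b + 2 * (n * η) := by rw [hη]; ring
  nlinarith

theorem exists_good (f : C(↥(SigmaD M N), ℝ)) (ε : ℝ) (hε : 0 < ε) : ∃ b, Good f b ∧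
      ∀ ν ∈ InvP (shiftD M N), ∫ x, f x ∂ν ≤ b + ε := by
  have hne : {b | Good f b}.Nonempty := ⟨_, good_bot f⟩
  have hbd : BddAbove {b | Good f b} := ⟨‖f‖, fun b hb => good_le hb⟩
  obtain ⟨b, hb, hlt⟩ := exists_lt_of_lt_csSup hne
    (show sSup {b | Good f b} - ε / 2 < sSup {b | Good f b} by linarith)
  refine ⟨b, hb, fun ν hν => ?_⟩
  by_contra hcon
  push Not at hcon
  have := select f hν hcon (show b + ε / 2 + ε / 4 < b + ε by linarith)
  have := le_csSup hbd (show _ ∈ {b | Good f b} from this)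
  linarith

end Rev

/-- Theorem A(b): there is a dense subset `𝒟` of `C(Σ_D)` such that for every `f ∈ 𝒟`,
`M_max(f)` contains uncountably many measures that are fully supported and Bernoulli. -/
theorem dense_uncountably_many_Bernoulli_maximizing (M N : ℕ) (hM : 2 ≤ M) :
    ∃ 𝒟 : Set C(↥(SigmaD M N), ℝ), Dense 𝒟 ∧
      ∀ f ∈ 𝒟, ∃ S : Set (ProbabilityMeasure ↥(SigmaD M N)),
        S ⊆ Mmax M N f ∧ ¬S.Countable ∧
        ∀ μ ∈ S, FullSupp μ ∧ IsBernoulli (shiftD M N) μ.toMeasure := by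
  haveI : NeZero M := ⟨by omega⟩
  exact final_of_good M N exists_good
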